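/- Let k be a field, A a finite-dimensional self-injective k-algebra, and M a finitely generated A-module that is a generator, self-orthogonal and Nakayama-stable. Then M is a projective A-module if and only if every A-module that is both M-compact and M-filtered lies in Add(M). (Theorem 1.2, equivalence of (1) and (3).) -/

import Mathlib

open CategoryTheory
/-! ## Additive closure classes -/

section AddClosure

variable (A : Type) [Ring A]

/-- `X ∈ add M`: `X` is a direct summand of a finite direct sum of copies of `M`. -/
def MemAdd (M X : ModuleCat.{0} A) : Prop :=
  ∃ (n : ℕ) (Y : ModuleCat.{0} A), Nonempty ((↥X × ↥Y) ≃ₗ[A] (Fin n → ↥M))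

/-- `X ∈ Add M`: `X` is a direct summand of an arbitrary direct sum of copies of `M`. -/
def MemAddBig (M X : ModuleCat.{0} A) : Prop :=
  ∃ (I : Type) (Y : ModuleCat.{0} A), Nonempty ((↥X × ↥Y) ≃ₗ[A] (I →₀ ↥M))

/-- a morphism of `A`-modules factors through a projective module -/
def FactorsThroughProj {X Y : ModuleCat.{0} A} (f : X ⟶ Y) : Prop :=
  ∃ (P : ModuleCat.{0} A) (_ : Module.Projective A P) (g : X ⟶ P) (h : P ⟶ Y), f = g ≫ h

/-- a morphism of `A`-modules factors through a module in `Add M` -/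
def FactorsThroughAddM (M : ModuleCat.{0} A) {X Y : ModuleCat.{0} A} (f : X ⟶ Y) : Prop :=
  ∃ (Z : ModuleCat.{0} A) (_ : MemAddBig A M Z) (g : X ⟶ Z) (h : Z ⟶ Y), f = g ≫ h

/-- `X ∈ add M` for unbundled modules. -/
def MemAddPlain (M : Type) [AddCommGroup M] [Module A M]
    (X : Type) [AddCommGroup X] [Module A X] : Prop :=
  ∃ (n : ℕ) (Y : ModuleCat.{0} A), Nonempty ((X × ↥Y) ≃ₗ[A] (Fin n → M))

end AddClosure

/-! ## Ext vanishing -/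

section ExtDefs

variable (A : Type) [Ring A]

/-- vanishing of `Ext^n_A(X, Y)` -/
noncomputable def extZero (n : ℕ) (X Y : ModuleCat.{0} A) : Prop :=
  Subsingleton (((Ext ℤ (ModuleCat.{0} A) n).obj (Opposite.op X)).obj Y)

/-- `M` is self-orthogonal: `Ext^n_A(M,M) = 0` for all `n ≥ 1`. -/
noncomputable def SelfOrthogonal (M : ModuleCat.{0} A) : Prop :=
  ∀ n : ℕ, 1 ≤ n → extZero A n M M

/-- `M` is a generator for `A`-mod: `A ∈ add M`. -/
def IsGen (M : ModuleCat.{0} A) : Prop :=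
  MemAdd A M (ModuleCat.of A A)

/-- membership in the `M`-Gorenstein subcategory `𝒢`:
`Ext^n_A(M,X) = 0 = Ext^n_A(X,M)` for all `n ≥ 1`. -/
noncomputable def MemG (M X : ModuleCat.{0} A) : Prop :=
  ∀ n : ℕ, 1 ≤ n → extZero A n M X ∧ extZero A n X M

end ExtDefs

/-! ## The Nakayama functor `ν_A = D ∘ Hom_A(-, A)` -/

section Nakayama

variable (k A : Type) [Field k] [Ring A] [Algebra k A]

/-- Right multiplication by `a : A` on `Hom_A(X, A)`, as a `k`-linear map. -/
@[simps] def rmulHom (X : Type) [AddCommGroup X] [Module A X] (a : A) :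
    (X →ₗ[A] A) →ₗ[k] (X →ₗ[A] A) where
  toFun f :=
    { toFun := fun x => f x * a
      map_add' := fun x y => by simp [add_mul]
      map_smul' := fun c x => by simp [mul_assoc] }
  map_add' f g := by ext x; simp [add_mul]
  map_smul' c f := by ext x; simp [Algebra.smul_def, mul_assoc]

/-- The carrier of the Nakayama functor value `ν_A(X) = D(Hom_A(X,A))`,
where `D = Hom_k(-,k)`. -/
abbrev NuCarrier (X : Type) [AddCommGroup X] [Module A X] : Type :=
  (X →ₗ[A] A) →ₗ[k] k

/-- The left `A`-module structure on `ν_A(X) = D(Hom_A(X,A))`: `(a • φ) f = φ (f · a)`. -/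
instance (X : Type) [AddCommGroup X] [Module A X] : Module A (NuCarrier k A X) where
  smul a φ := φ.comp (rmulHom k A X a)
  one_smul φ := by
    refine LinearMap.ext fun f => ?_
    exact congrArg φ (by ext x; simp)
  mul_smul a b φ := by
    refine LinearMap.ext fun f => ?_
    exact congrArg φ (by ext x; simp [mul_assoc])
  smul_zero a := rfl
  smul_add a φ ψ := rfl
  add_smul a b φ := by
    refine LinearMap.ext fun f => ?_
    show φ ((rmulHom k A X (a + b)) f) = φ ((rmulHom k A X a) f) + φ ((rmulHom k A X b) f)
    rw [show (rmulHom k A X (a + b)) f = (rmulHom k A X a) f + (rmulHom k A X b) f from by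
      ext x; simp [mul_add]]
    exact map_add φ _ _
  zero_smul φ := by
    refine LinearMap.ext fun f => ?_
    show φ ((rmulHom k A X 0) f) = 0
    rw [show (rmulHom k A X 0) f = 0 from by ext x; simp]
    exact map_zero φ

/-- The Nakayama functor value `ν_A(X)` as an object of `ModuleCat A`. -/
noncomputable def NuMod (X : ModuleCat.{0} A) : ModuleCat.{0} A :=
  ModuleCat.of A (NuCarrier k A ↥X)

/-- `M` is Nakayama-stable: `add M = add (ν_A M)`. -/
noncomputable def NakayamaStable (M : ModuleCat.{0} A) : Prop :=
  ∀ X : ModuleCat.{0} A, MemAdd A M X ↔ MemAdd A (NuMod k A M) X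

end Nakayama

/-! ## Minimal injective coresolutions, cosyzygies, `M`-filtered modules -/

section Cosyzygy

variable (A : Type) [Ring A]

/-- `ι : N ⟶ I` is an injective envelope: `I` is injective, `ι` is injective,
and the image of `ι` is an essential submodule of `I`. -/
def IsInjEnvelope {N I : ModuleCat.{0} A} (ι : N ⟶ I) : Prop :=
  Module.Injective A ↥I ∧ Function.Injective ι ∧
    ∀ K : Submodule A ↥I, K ⊓ LinearMap.range ι.hom = ⊥ → K = ⊥

/-- `C` is the sequence of cosyzygies of `M` along a minimal injective coresolution:
`C 0 ≅ M` and for each `n` there is a short exact sequence `0 → C n → I → C (n+1) → 0`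
in which `C n → I` is an injective envelope. -/
def IsMinInjCoresolution (M : ModuleCat.{0} A) (C : ℕ → ModuleCat.{0} A) : Prop :=
  Nonempty (C 0 ≅ M) ∧
    ∀ n, ∃ (I : ModuleCat.{0} A) (ι : C n ⟶ I) (p : I ⟶ C (n + 1)),
      IsInjEnvelope A ι ∧ Function.Surjective p ∧ LinearMap.range ι.hom = LinearMap.ker p.hom

/-- the family of modules `{A} ∪ {C i | i ∈ ℕ}`, indexed by `Option ℕ`. -/
def optPick (C : ℕ → ModuleCat.{0} A) : Option ℕ → ModuleCat.{0} A
  | none => ModuleCat.of A A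
  | some i => C i

/-- `Q` is isomorphic to a finite direct sum of modules from `{A} ∪ {C i | i ∈ ℕ}`. -/
def IsFinSumFrom (C : ℕ → ModuleCat.{0} A) (Q : Type) [AddCommGroup Q] [Module A Q] : Prop :=
  ∃ (m : ℕ) (T : Fin m → Option ℕ),
    Nonempty (Q ≃ₗ[A] ((j : Fin m) → ↥(optPick A C (T j))))

/-- `X` is `M`-filtered (where `C` encodes the cosyzygies `Ω_A^{-i}(M)`, `C 0 ≅ M`):
there is an ascending chain `0 = X₀ ⊆ X₁ ⊆ ⋯` of submodules with union `X` all of whose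
subquotients are finite direct sums of modules from `{A} ∪ {Ω_A^{-i}(M) | i ∈ ℕ}`. -/
def MFiltered (C : ℕ → ModuleCat.{0} A) (X : ModuleCat.{0} A) : Prop :=
  ∃ F : ℕ → Submodule A ↥X,
    Monotone F ∧ F 0 = ⊥ ∧ (⨆ n, F n) = ⊤ ∧
      ∀ n, IsFinSumFrom A C
        (↥(F (n + 1)) ⧸ (Submodule.comap (F (n + 1)).subtype (F n)))

/-- `X` is finitely `M`-filtered: as `MFiltered`, with a chain that reaches `⊤`
after finitely many steps. -/
def FinMFiltered (C : ℕ → ModuleCat.{0} A) (X : ModuleCat.{0} A) : Prop :=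
  ∃ F : ℕ → Submodule A ↥X,
    Monotone F ∧ F 0 = ⊥ ∧ (∃ n, F n = ⊤) ∧
      ∀ n, IsFinSumFrom A C
        (↥(F (n + 1)) ⧸ (Submodule.comap (F (n + 1)).subtype (F n)))

end Cosyzygy

/-! ## Relative stable Hom-groups and `M`-compact objects -/

section StableM

variable (A : Type) [Ring A]

/-- the subgroup of `Hom_A(X,Y)` generated by morphisms factoring through `Add M` -/
def addMSub (M X Y : ModuleCat.{0} A) : AddSubgroup (X ⟶ Y) :=
  AddSubgroup.closure {f : X ⟶ Y | FactorsThroughAddM A M f}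

/-- the relative stable Hom-group `StHom_M(X,Y) = Hom_A(X,Y)/[M]` -/
def StHomM (M X Y : ModuleCat.{0} A) : Type :=
  (X ⟶ Y) ⧸ addMSub A M X Y

instance (M X Y : ModuleCat.{0} A) : AddCommGroup (StHomM A M X Y) :=
  inferInstanceAs (AddCommGroup ((X ⟶ Y) ⧸ addMSub A M X Y))

/-- postcomposition as an additive map on Hom-groups. -/
def postCompHom {Y Z : ModuleCat.{0} A} (X : ModuleCat.{0} A) (h : Y ⟶ Z) :
    (X ⟶ Y) →+ (X ⟶ Z) :=
  AddMonoidHom.mk' (fun f => f ≫ h) (fun f g => by simp [Preadditive.add_comp])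

/-- postcomposition descends to the relative stable Hom-groups. -/
def stPostComp (M : ModuleCat.{0} A) (X : ModuleCat.{0} A) {Y Z : ModuleCat.{0} A}
    (h : Y ⟶ Z) : StHomM A M X Y →+ StHomM A M X Z :=
  QuotientAddGroup.map _ _ (postCompHom A X h) (by
    rw [addMSub, AddSubgroup.closure_le]
    rintro f ⟨W, hW, u, v, rfl⟩
    rw [SetLike.mem_coe, AddSubgroup.mem_comap]
    exact AddSubgroup.subset_closure ⟨W, hW, u, v ≫ h, by simp [postCompHom]⟩)

/-- the canonical map `⊕ᵢ StHom_M(X, Y i) → StHom_M(X, ⊕ᵢ Y i)`. -/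
noncomputable def stCanonMap (M X : ModuleCat.{0} A) (I : Type) (Y : I → ModuleCat.{0} A) :
    DirectSum I (fun i => StHomM A M X (Y i)) →+ StHomM A M X (∐ Y) :=
  letI : DecidableEq I := Classical.decEq I
  DirectSum.toAddMonoid fun i => stPostComp A M X (Limits.Sigma.ι Y i)

/-- `X` is `M`-compact: `X ∈ 𝒢` and for every family `(Y i)` in `𝒢` the canonical map
`⊕ᵢ StHom_M(X, Y i) → StHom_M(X, ⊕ᵢ Y i)` is bijective. -/
noncomputable def MCompact (M X : ModuleCat.{0} A) : Prop :=
  MemG A M X ∧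
    ∀ (I : Type) (Y : I → ModuleCat.{0} A), (∀ i, MemG A M (Y i)) →
      Function.Bijective (stCanonMap A M X I Y)

end StableM

/-! ## Factoring linear maps through kernels and quotients -/

section Factoring

variable {A X Y Z : Type*} [Ring A] [AddCommGroup X] [Module A X] [AddCommGroup Y] [Module A Y]
  [AddCommGroup Z] [Module A Z]

theorem LinearMap.exists_comp_eq_of_surjective (p : X →ₗ[A] Y) (hp : Function.Surjective p)
    (f : X →ₗ[A] Z) (hf : ∀ x, p x = 0 → f x = 0) : ∃ g : Y →ₗ[A] Z, g ∘ₗ p = f := by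
  refine ⟨p.ker.liftQ f (fun x hx => hf x hx) ∘ₗ
    (p.quotKerEquivOfSurjective hp).symm.toLinearMap, LinearMap.ext fun x => ?_⟩
  have e : (p.quotKerEquivOfSurjective hp).symm (p x) = Submodule.Quotient.mk x := by
    rw [LinearEquiv.symm_apply_eq]; rfl
  simp only [LinearMap.comp_apply, LinearEquiv.coe_coe, e]
  rfl

theorem LinearMap.exists_comp_eq_of_injective (i : Y →ₗ[A] X) (hi : Function.Injective i)
    (f : Z →ₗ[A] X) (hf : ∀ z, ∃ y, i y = f z) : ∃ g : Z →ₗ[A] Y, i ∘ₗ g = f :=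
  ⟨(LinearEquiv.ofInjective i hi).symm.toLinearMap ∘ₗ f.codRestrict i.range hf,
    LinearMap.ext fun z => congrArg Subtype.val
      ((LinearEquiv.ofInjective i hi).apply_symm_apply (f.codRestrict i.range hf z))⟩

end Factoring

/-! ## Computing `Ext` from a tower of syzygies -/

section SyzygyTowers

variable {A : Type} [Ring A]

theorem extZero_succ_iff_of_resolution {X : ModuleCat.{0} A} (R : ProjectiveResolution X) (n : ℕ)
    (Y : ModuleCat.{0} A) :
    extZero A (n + 1) X Y ↔
      ∀ f : R.complex.X (n + 1) ⟶ Y, R.complex.d (n + 2) (n + 1) ≫ f = 0 →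
        ∃ g : R.complex.X n ⟶ Y, R.complex.d (n + 1) n ≫ g = f := by
  unfold extZero
  rw [← ModuleCat.isZero_iff_subsingleton, (R.isoExt (R := ℤ) (n + 1) Y).isZero_iff,
    ← HomologicalComplex.exactAt_iff_isZero_homology,
    HomologicalComplex.exactAt_iff' _ n (n + 1) (n + 2) (by simp) (by simp),
    ShortComplex.moduleCat_exact_iff]
  rfl

/-- A tower of syzygies: short exact sequences `0 → K (n+1) → P n → K n → 0` with `P n`
projective. -/
structure SyzygyTower (A : Type) [Ring A] (K P : ℕ → ModuleCat.{0} A) where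
  /-- the inclusion of the next syzygy -/
  i : ∀ n, K (n + 1) →ₗ[A] P n
  /-- the projective cover-like surjection -/
  p : ∀ n, P n →ₗ[A] K n
  projective : ∀ n, Module.Projective A (P n)
  injective_i : ∀ n, Function.Injective (i n)
  surjective_p : ∀ n, Function.Surjective (p n)
  exact : ∀ n, Function.Exact (i n) (p n)

namespace SyzygyTower

variable {K P : ℕ → ModuleCat.{0} A} (T : SyzygyTower A K P)

/-- The chain complex spliced from a tower of syzygies. -/
noncomputable def complex : ChainComplex (ModuleCat.{0} A) ℕ :=
  ChainComplex.of P (fun n => ModuleCat.ofHom (T.i n ∘ₗ T.p (n + 1))) (fun n => by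
    ext x
    exact (congrArg (T.i n) ((T.exact (n + 1)).apply_apply_eq_zero (T.p (n + 2) x))).trans
      (map_zero _))

theorem complex_d (n : ℕ) :
    T.complex.d (n + 1) n = ModuleCat.ofHom (T.i n ∘ₗ T.p (n + 1)) :=
  ChainComplex.of_d P (fun n => ModuleCat.ofHom (T.i n ∘ₗ T.p (n + 1))) n

theorem complex_d_apply (n : ℕ) (x : P (n + 1)) :
    (T.complex.d (n + 1) n).hom x = T.i n (T.p (n + 1) x) := by
  rw [complex_d]; rfl

/-- The projective resolution spliced from a tower of syzygies. -/
noncomputable def resolution : ProjectiveResolution (K 0) where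
  complex := T.complex
  projective n := (IsProjective.iff_projective (P n)).1 (T.projective n)
  π := (ChainComplex.toSingle₀Equiv _ _).symm ⟨ModuleCat.ofHom (T.p 0), by
    rw [complex_d]
    ext x
    exact (T.exact 0).apply_apply_eq_zero (T.p 1 x)⟩
  quasiIso := ⟨fun n => by
    cases n with
    | zero =>
      rw [ChainComplex.quasiIsoAt₀_iff, ShortComplex.quasiIso_iff_of_zeros']
      · constructor
        · rw [ShortComplex.moduleCat_exact_iff]
          intro (x : P 0) hx
          have hx' : T.p 0 x = 0 := by
            refine Eq.trans ?_ hx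
            simp only [HomologicalComplex.shortComplexFunctor'_map_τ₂]
            rfl
          obtain ⟨y, rfl⟩ := (T.exact 0 x).1 hx'
          obtain ⟨z, rfl⟩ := T.surjective_p 1 y
          exact ⟨z, T.complex_d_apply 0 z⟩
        · rw [ModuleCat.epi_iff_surjective]
          simp only [HomologicalComplex.shortComplexFunctor'_map_τ₂]
          exact T.surjective_p 0
      all_goals rfl
    | succ n =>
      rw [quasiIsoAt_iff_exactAt']
      · rw [HomologicalComplex.exactAt_iff' _ (n + 2) (n + 1) n (by simp) (by simp),
          ShortComplex.moduleCat_exact_iff]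
        intro (x : P (n + 1)) hx
        have hx' : T.i n (T.p (n + 1) x) = 0 := (T.complex_d_apply n x).symm.trans hx
        obtain ⟨y, rfl⟩ := (T.exact (n + 1) x).1
          (T.injective_i n (hx'.trans (map_zero _).symm))
        obtain ⟨z, rfl⟩ := T.surjective_p (n + 2) y
        exact ⟨z, T.complex_d_apply (n + 1) z⟩
      · apply ChainComplex.exactAt_succ_single_obj⟩

/-- `Ext^(n+1)` out of the bottom of a tower vanishes iff all maps out of the `(n+1)`-st syzygy
extend along `K (n+1) → P n`. -/
theorem extZero_succ_iff (n : ℕ) (Y : ModuleCat.{0} A) :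
    extZero A (n + 1) (K 0) Y ↔
      ∀ f : K (n + 1) →ₗ[A] Y, ∃ g : P n →ₗ[A] Y, g ∘ₗ T.i n = f := by
  rw [extZero_succ_iff_of_resolution T.resolution]
  change (∀ f : P (n + 1) ⟶ Y, T.complex.d (n + 2) (n + 1) ≫ f = 0 →
        ∃ g : P n ⟶ Y, T.complex.d (n + 1) n ≫ g = f) ↔ _
  simp only [complex_d]
  constructor
  · intro h f
    obtain ⟨g, hg⟩ := h (ModuleCat.ofHom (f ∘ₗ T.p (n + 1))) (by
      ext x
      exact (congrArg f ((T.exact (n + 1)).apply_apply_eq_zero (T.p (n + 2) x))).trans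
        (map_zero _))
    refine ⟨g.hom, LinearMap.ext fun x => ?_⟩
    obtain ⟨z, rfl⟩ := T.surjective_p (n + 1) x
    exact congrArg (fun φ : P (n + 1) ⟶ Y => φ.hom z) hg
  · intro h f hf
    have hker : ∀ x, T.p (n + 1) x = 0 → f.hom x = 0 := fun x hx => by
      obtain ⟨y, rfl⟩ := (T.exact (n + 1) x).1 hx
      obtain ⟨z, rfl⟩ := T.surjective_p (n + 2) y
      exact congrArg (fun φ : P (n + 2) ⟶ Y => φ.hom z) hf
    obtain ⟨f', hf'⟩ := (T.p (n + 1)).exists_comp_eq_of_surjective (T.surjective_p _) f.hom hker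
    obtain ⟨g, hg⟩ := h f'
    refine ⟨ModuleCat.ofHom g, ModuleCat.hom_ext ?_⟩
    subst hg
    exact hf'

end SyzygyTower

end SyzygyTowers

/-! ## Finite-dimensional self-injective algebras are quasi-Frobenius -/

section QuasiFrobenius

/-- The `k`-structure on a module over a `k`-algebra. -/
abbrev restrictModule (k A X : Type) [Field k] [Ring A] [Algebra k A] [AddCommGroup X]
    [Module A X] : Module k X :=
  Module.compHom X (algebraMap k A)

theorem restrictModule_isScalarTower (k A X : Type) [Field k] [Ring A] [Algebra k A]
    [AddCommGroup X] [Module A X] :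
    letI := restrictModule k A X
    IsScalarTower k A X :=
  letI := restrictModule k A X
  ⟨fun c a x => by
    rw [Algebra.smul_def, mul_smul]
    rfl⟩

theorem isSimpleModule_quotient_equiv_of_annihilator_le (k : Type) {A S : Type} [Field k] [Ring A]
    [Algebra k A] [FiniteDimensional k A] [AddCommGroup S] [Module A S] [IsSimpleModule A S]
    (I : Ideal A) [I.IsMaximal] (h : Module.annihilator A S ≤ I) : Nonempty ((A ⧸ I) ≃ₗ[A] S) := by
  let := restrictModule k A S
  have := restrictModule_isScalarTower k A S
  have : Module.Finite k S := Module.Finite.trans A S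
  obtain ⟨r, s, hs⟩ := Module.Finite.exists_fin (R := k) (M := S)
  let φ : A →ₗ[A] (Fin r → S) := LinearMap.pi fun i => LinearMap.toSpanSingleton A S (s i)
  have hker : ∀ a, φ a = 0 → a ∈ I := fun a ha => h <| by
    rw [Module.mem_annihilator]
    intro x
    have hx : x ∈ Submodule.span k (Set.range s) := hs ▸ Submodule.mem_top
    induction hx using Submodule.span_induction with
    | mem x hx => obtain ⟨i, rfl⟩ := hx; exact congrFun ha i
    | zero => simp
    | add x y _ _ hx hy => rw [smul_add, hx, hy, add_zero]
    | smul c x _ hx => rw [smul_algebra_smul_comm, hx, smul_zero]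
  have : IsSimpleModule A (A ⧸ I) := isSimpleModule_iff_quot_maximal.2
    ⟨I, inferInstance, ⟨LinearEquiv.refl A _⟩⟩
  obtain ⟨q, hq⟩ := LinearMap.exists_comp_eq_of_surjective φ.rangeRestrict
    φ.surjective_rangeRestrict I.mkQ (fun a ha => by
      rw [Submodule.mkQ_apply, Submodule.Quotient.mk_eq_zero]
      exact hker a (congrArg Subtype.val ha))
  have hqs : Function.Surjective q := by
    have := I.mkQ_surjective
    rw [← hq, LinearMap.coe_comp] at this
    exact this.of_comp
  obtain ⟨N, hN⟩ := exists_isCompl q.ker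
  let e := ((Submodule.quotientEquivOfIsCompl _ _ hN).symm.trans
    (q.quotKerEquivOfSurjective hqs)).symm
  obtain ⟨i, hi⟩ : ∃ i : Fin r,
      (LinearMap.proj i ∘ₗ φ.range.subtype ∘ₗ N.subtype ∘ₗ e.toLinearMap) ≠ 0 := by
    by_contra! hcon
    have := IsSimpleModule.nontrivial A (A ⧸ I)
    obtain ⟨x, hx⟩ := exists_ne (0 : A ⧸ I)
    apply hx
    apply e.injective
    rw [map_zero]
    ext i
    exact congrArg (fun f => f x) (hcon i)
  exact ⟨LinearEquiv.ofBijective _ (LinearMap.bijective_of_ne_zero hi)⟩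

theorem isArtinianRing_of_finiteDimensional (k A : Type) [Field k] [Ring A] [Algebra k A] [FiniteDimensional k A] :
     IsArtinianRing A :=
  isArtinian_of_tower k inferInstance

theorem exists_simple_submodule_quotient_jacobson (k A : Type) [Field k] [Ring A] [Algebra k A] [FiniteDimensional k A]
    (S : Type) [AddCommGroup S] [Module A S]
    [IsSimpleModule A S] :
    ∃ N : Submodule A (A ⧸ Ring.jacobson A), Nonempty (N ≃ₗ[A] S) := by
  have := isArtinianRing_of_finiteDimensional k A
  have : IsSemisimpleModule A (A ⧸ Ring.jacobson A) :=
    (IsArtinian.isSemisimpleModule_iff_jacobson _ _).2 (Module.jacobson_quotient_jacobson A A)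
  obtain ⟨I, hI, ⟨e⟩⟩ := isSimpleModule_iff_quot_maximal.1 (inferInstance : IsSimpleModule A S)
  let q : (A ⧸ Ring.jacobson A) →ₗ[A] A ⧸ I :=
    Submodule.factor (Ring.jacobson_le_of_isMaximal I)
  have hq : Function.Surjective q := Submodule.factor_surjective _
  obtain ⟨N, hN⟩ := exists_isCompl q.ker
  exact ⟨N, ⟨((Submodule.quotientEquivOfIsCompl _ _ hN).symm.trans
    (q.quotKerEquivOfSurjective hq)).trans e.symm⟩⟩

theorem exists_mul_eq_of_linearMap (A : Type) [Ring A] [Module.Injective A A] (I : Ideal A) (f : I →ₗ[A] A) :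
    ∃ a : A, ∀ x : I, f x = x * a := by
  obtain ⟨h, hh⟩ := Module.Injective.extension_property A A _ _ I.subtype I.injective_subtype f
  exact ⟨h 1, fun x => by
    rw [← hh, LinearMap.comp_apply, Submodule.subtype_apply, ← smul_eq_mul, ← map_smul,
      smul_eq_mul, mul_one]⟩

theorem exists_ne_zero_mul_eq_zero (k A : Type) [Field k] [Ring A] [Algebra k A] [FiniteDimensional k A]
    [Module.Injective A A] (I : Ideal A) [I.IsTwoSided] (hI : I ≠ ⊤) :
    ∃ x : A, x ≠ 0 ∧ ∀ m ∈ I, x * m = 0 := by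
  by_contra! hcon
  obtain ⟨r, s, hs⟩ := Module.Finite.exists_fin (R := k) (M := I.restrictScalars k)
  let φ : A →ₗ[A] (Fin r → A) := LinearMap.pi fun i => LinearMap.toSpanSingleton A A (s i : A)
  have hφ : Function.Injective φ := by
    rw [injective_iff_map_eq_zero]
    intro x hx
    by_contra hx0
    obtain ⟨m, hm, hxm⟩ := hcon x hx0
    have hms : (⟨m, hm⟩ : I.restrictScalars k) ∈ Submodule.span k (Set.range s) :=
      hs ▸ Submodule.mem_top
    apply hxm
    have : ∀ y : I.restrictScalars k, y ∈ Submodule.span k (Set.range s) → x * (y : A) = 0 := by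
      intro y hy
      induction hy using Submodule.span_induction with
      | mem y hy => obtain ⟨i, rfl⟩ := hy; exact congrFun hx i
      | zero => simp
      | add y z _ _ hy hz =>
        rw [Submodule.coe_add, mul_add, hy, hz, add_zero]
      | smul c y _ hy => rw [Submodule.coe_smul, mul_smul_comm, hy, smul_zero]
    exact this _ hms
  obtain ⟨g, hg⟩ := Module.Injective.extension_property A A _ _ φ hφ LinearMap.id
  apply hI
  rw [Ideal.eq_top_iff_one]
  have h1 : g (φ 1) = 1 := congrArg (fun f => f 1) hg
  rw [← h1, LinearMap.pi_apply_eq_sum_univ g]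
  refine Ideal.sum_mem _ fun i _ => ?_
  have : φ 1 i = s i := one_smul A _
  rw [this]
  exact I.mul_mem_right _ (s i).2

theorem exists_simple_ideal_mul_eq_zero (k A : Type) [Field k] [Ring A] [Algebra k A] [FiniteDimensional k A]
    [Module.Injective A A] (I : Ideal A) [I.IsTwoSided] (hI : I ≠ ⊤) :
    ∃ T : Ideal A, IsSimpleModule A T ∧ ∀ x ∈ T, ∀ m ∈ I, x * m = 0 := by
  have := isArtinianRing_of_finiteDimensional k A
  obtain ⟨x, hx, hxI⟩ := exists_ne_zero_mul_eq_zero k A I hI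
  obtain h | ⟨T, hT, hTx⟩ := IsAtomic.eq_bot_or_exists_atom_le (Ideal.span {x})
  · exact absurd (Ideal.span_singleton_eq_bot.1 h) hx
  · refine ⟨T, isSimpleModule_iff_isAtom.2 hT, fun y hy m hm => ?_⟩
    obtain ⟨a, rfl⟩ := Ideal.mem_span_singleton'.1 (hTx hy)
    rw [mul_assoc, hxI m hm, mul_zero]

/-- Over a finite-dimensional self-injective algebra every simple module embeds into the
algebra. -/
theorem exists_simple_ideal_equiv (k A : Type) [Field k] [Ring A] [Algebra k A] [FiniteDimensional k A]
    [Module.Injective A A] (S : Type) [AddCommGroup S] [Module A S] [IsSimpleModule A S] :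
    ∃ T : Ideal A, Nonempty (T ≃ₗ[A] S) := by
  have := isArtinianRing_of_finiteDimensional k A
  let B := A ⧸ Ring.jacobson A
  have key : ∀ c : isotypicComponents A B, ∃ (U : Submodule A B) (T : Ideal A)
      (V : Submodule A B), IsSimpleModule A U ∧ c.1 = isotypicComponent A B U ∧
      IsSimpleModule A T ∧ IsSimpleModule A V ∧
      Nonempty (V ≃ₗ[A] T) ∧ ∀ x ∈ T, ∀ m ∈ Module.annihilator A U, x * m = 0 := by
    rintro ⟨_, U, hU, rfl⟩
    obtain ⟨T, hT, hTU⟩ := exists_simple_ideal_mul_eq_zero k A (Module.annihilator A U) (by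
      rw [Ne, Ideal.eq_top_iff_one, Module.mem_annihilator]
      intro h
      have := IsSimpleModule.nontrivial A U
      obtain ⟨x, hx⟩ := exists_ne (0 : U)
      exact hx (by simpa using h x))
    obtain ⟨V, ⟨e⟩⟩ := exists_simple_submodule_quotient_jacobson k A T
    exact ⟨U, T, V, hU, rfl, hT, IsSimpleModule.congr e, ⟨e⟩, hTU⟩
  choose U T V hU hcU hT hV hVT hTU using key
  let Φ : isotypicComponents A B → isotypicComponents A B := fun c =>
    ⟨isotypicComponent A B (V c), V c, hV c, rfl⟩
  have equiv_of_eq : ∀ N N' : Submodule A B, IsSimpleModule A N → IsSimpleModule A N' →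
      isotypicComponent A B N = isotypicComponent A B N' → Nonempty (N ≃ₗ[A] N') := by
    intro N N' hN hN' h
    exact isIsotypicOfType_submodule_iff.1
      (IsIsotypicOfType.isotypicComponent A B N') N (h ▸ N.le_isotypicComponent)
  have hΦ : Function.Injective Φ := by
    intro c c' h
    obtain ⟨e₁⟩ := equiv_of_eq _ _ (hV c) (hV c') (congrArg Subtype.val h)
    obtain ⟨e⟩ := hVT c
    obtain ⟨e'⟩ := hVT c'
    let ψ : T c ≃ₗ[A] T c' := e.symm.trans (e₁.trans e')
    obtain ⟨a, ha⟩ := exists_mul_eq_of_linearMap A (T c) ((T c').subtype ∘ₗ ψ.toLinearMap)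
    have hne : Module.annihilator A (U c) ⊔ Module.annihilator A (U c') ≠ ⊤ := by
      rw [Ne, Ideal.eq_top_iff_one]
      intro h1
      obtain ⟨m, hm, m', hm', hmm⟩ := Submodule.mem_sup.1 h1
      have := hT c'
      have := IsSimpleModule.nontrivial A (T c')
      obtain ⟨x, hx⟩ := exists_ne (0 : T c')
      apply hx
      ext
      rw [← mul_one (x : A), ← hmm, mul_add, hTU c' x x.2 m' hm']
      have h2 : (x : A) = ψ.symm x * a := by
        rw [← ha]; simp
      rw [h2, mul_assoc, hTU c _ (ψ.symm x).2 _ (Ideal.mul_mem_left _ a hm)]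
      simp
    obtain ⟨I, hI, hle⟩ := Ideal.exists_le_maximal _ hne
    have := hU c
    have := hU c'
    obtain ⟨f⟩ := isSimpleModule_quotient_equiv_of_annihilator_le k (S := U c) I
      (le_sup_left.trans hle)
    obtain ⟨f'⟩ := isSimpleModule_quotient_equiv_of_annihilator_le k (S := U c') I
      (le_sup_right.trans hle)
    ext1
    rw [hcU, hcU, (f.symm.trans f').isotypicComponent_eq]
  obtain ⟨N, ⟨e⟩⟩ := exists_simple_submodule_quotient_jacobson k A S
  have : IsSimpleModule A N := IsSimpleModule.congr e
  obtain ⟨c, hc⟩ := Finite.surjective_of_injective hΦ ⟨isotypicComponent A B N, N, ‹_›, rfl⟩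
  obtain ⟨g⟩ := equiv_of_eq _ _ (hV c) ‹_› (congrArg Subtype.val hc)
  exact ⟨T c, ⟨(hVT c).some.symm.trans (g.trans e)⟩⟩

theorem exists_linearMap_apply_ne_zero (k A : Type) [Field k] [Ring A] [Algebra k A] [FiniteDimensional k A]
    [Module.Injective A A] {N : Type} [AddCommGroup N] [Module A N] {x : N}
    (hx : x ≠ 0) : ∃ f : N →ₗ[A] A, f x ≠ 0 := by
  have hne : (LinearMap.toSpanSingleton A N x).ker ≠ ⊤ := by
    rw [Ne, Ideal.eq_top_iff_one, LinearMap.mem_ker]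
    simpa using hx
  obtain ⟨I, hI, hle⟩ := Ideal.exists_le_maximal _ hne
  have : IsSimpleModule A (A ⧸ I) := isSimpleModule_iff_quot_maximal.2
    ⟨I, inferInstance, ⟨LinearEquiv.refl A _⟩⟩
  obtain ⟨T, ⟨e⟩⟩ := exists_simple_ideal_equiv k A (A ⧸ I)
  obtain ⟨q, hq⟩ := LinearMap.exists_comp_eq_of_surjective
    (LinearMap.toSpanSingleton A N x).rangeRestrict
    (LinearMap.surjective_rangeRestrict _) I.mkQ (fun a ha => by
      rw [Submodule.mkQ_apply, Submodule.Quotient.mk_eq_zero]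
      exact hle (congrArg Subtype.val ha))
  obtain ⟨f, hf⟩ := Module.Injective.extension_property A A _ _
    (LinearMap.toSpanSingleton A N x).range.subtype (Submodule.injective_subtype _)
    (T.subtype ∘ₗ e.symm.toLinearMap ∘ₗ q)
  refine ⟨f, fun h0 => ?_⟩
  have h1 : f x = T.subtype (e.symm (q ((LinearMap.toSpanSingleton A N x).rangeRestrict 1))) := by
    have := LinearMap.congr_fun hf ((LinearMap.toSpanSingleton A N x).rangeRestrict 1)
    simpa using this
  have h2 : q ((LinearMap.toSpanSingleton A N x).rangeRestrict 1) = I.mkQ 1 := by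
    rw [← hq]; rfl
  rw [h0, h2, eq_comm, Submodule.subtype_apply, ZeroMemClass.coe_eq_zero,
    LinearEquiv.map_eq_zero_iff, Submodule.mkQ_apply, Submodule.Quotient.mk_eq_zero] at h1
  exact hI.ne_top (I.eq_top_iff_one.2 h1)

/-- Over a finite-dimensional self-injective algebra every finitely generated module embeds into
a finitely generated free module. -/
theorem exists_injective_to_free (k A : Type) [Field k] [Ring A] [Algebra k A] [FiniteDimensional k A]
    [Module.Injective A A] (N : Type) [AddCommGroup N] [Module A N] [Module.Finite A N] :
    ∃ (n : ℕ) (f : N →ₗ[A] (Fin n → A)), Function.Injective f := by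
  let := restrictModule k A N
  have := restrictModule_isScalarTower k A N
  have : Module.Finite k N := Module.Finite.trans A N
  obtain ⟨n, s, hs⟩ := Module.Finite.exists_fin (R := k) (M := N →ₗ[A] A)
  refine ⟨n, LinearMap.pi s, (injective_iff_map_eq_zero _).2 fun x hx => ?_⟩
  by_contra hx0
  obtain ⟨f, hf⟩ := exists_linearMap_apply_ne_zero k A hx0
  apply hf
  have hfs : f ∈ Submodule.span k (Set.range s) := hs ▸ Submodule.mem_top
  induction hfs using Submodule.span_induction with
  | mem f hf' => obtain ⟨i, rfl⟩ := hf'; exact congrFun hx i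
  | zero => simp
  | add f g _ _ hf hg => by_contra! h; simp_all
  | smul c f _ hf => by_contra! h; simp_all

/-- Over a finite-dimensional self-injective algebra, finitely generated injective modules are
projective. -/
theorem projective_of_injective_of_finite (k A : Type) [Field k] [Ring A] [Algebra k A] [FiniteDimensional k A]
    [Module.Injective A A] (N : Type) [AddCommGroup N] [Module A N]
    [Module.Finite A N] [Module.Injective A N] : Module.Projective A N := by
  obtain ⟨n, f, hf⟩ := exists_injective_to_free k A N
  obtain ⟨g, hg⟩ := Module.Injective.extension_property A N _ _ f hf LinearMap.id
  exact Module.Projective.of_split f g hg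

/-- Over a finite-dimensional self-injective algebra, projective modules are injective. -/
theorem injective_of_projective (k A : Type) [Field k] [Ring A] [Algebra k A] [FiniteDimensional k A]
    [Module.Injective A A] (N : Type) [AddCommGroup N] [Module A N]
    [Module.Projective A N] : Module.Injective A N := by
  have : IsNoetherianRing A := isNoetherian_of_tower k inferInstance
  have hfree : Module.Baer A (N →₀ A) := by
    intro I g
    obtain ⟨n, s, hs⟩ := Module.Finite.exists_fin (R := A) (M := I)
    classical
    let F : Finset N := Finset.univ.biUnion fun i => (g (s i)).support
    have hF : ∀ x : I, (g x).support ⊆ F := by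
      intro x
      have hx : x ∈ Submodule.span A (Set.range s) := hs ▸ Submodule.mem_top
      induction hx using Submodule.span_induction with
      | mem x hx =>
        obtain ⟨i, rfl⟩ := hx
        exact Finset.subset_biUnion_of_mem (fun i => (g (s i)).support) (Finset.mem_univ i)
      | zero => simp
      | add x y _ _ hx hy =>
        rw [map_add]; exact Finsupp.support_add.trans (Finset.union_subset hx hy)
      | smul c x _ hx => rw [map_smul]; exact Finsupp.support_smul.trans hx
    choose a ha using fun j => exists_mul_eq_of_linearMap A I (Finsupp.lapply j ∘ₗ g)
    refine ⟨LinearMap.toSpanSingleton A _ (∑ j ∈ F, Finsupp.single j (a j)), fun x hx => ?_⟩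
    ext j
    have hj := ha j ⟨x, hx⟩
    rw [LinearMap.comp_apply, Finsupp.lapply_apply] at hj
    by_cases hjF : j ∈ F
    · simp [Finsupp.single_apply, hjF, hj]
    · have := Finsupp.notMem_support_iff.1 fun h => hjF (hF ⟨x, hx⟩ h)
      simp [Finsupp.single_apply, hjF, this]
  have := hfree.injective
  obtain ⟨s, hs⟩ := Module.projective_def'.1 (inferInstance : Module.Projective A N)
  refine ⟨fun X Y _ _ _ _ f hf g => ?_⟩
  obtain ⟨h, hh⟩ := Module.Injective.out f hf (s ∘ₗ g)
  refine ⟨Finsupp.linearCombination A id ∘ₗ h, fun x => ?_⟩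
  rw [LinearMap.comp_apply, hh]
  exact congrArg (fun φ => φ (g x)) hs

end QuasiFrobenius

/-! ## Maps factoring through projective modules -/

section NullMaps

/-- All projective `A`-modules are injective. -/
class ProjectivesInjective (A : Type) [Ring A] : Prop where
  injective : ∀ (N : Type) [AddCommGroup N] [Module A N] [Module.Projective A N],
    Module.Injective A N

/-- A short exact sequence `0 → X → Y → Z → 0` of modules. -/
structure IsShortExact {A X Y Z : Type} [Ring A] [AddCommGroup X] [Module A X] [AddCommGroup Y]
    [Module A Y] [AddCommGroup Z] [Module A Z] (i : X →ₗ[A] Y) (p : Y →ₗ[A] Z) : Prop where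
  injective : Function.Injective i
  exact : Function.Exact i p
  surjective : Function.Surjective p

/-- The module `K` is the kernel of a surjection from a projective module onto `X`. -/
def IsSyzygy (A K X : Type) [Ring A] [AddCommGroup K] [Module A K] [AddCommGroup X]
    [Module A X] : Prop :=
  ∃ (P : ModuleCat.{0} A) (_ : Module.Projective A P) (i : K →ₗ[A] P) (p : P →ₗ[A] X),
    IsShortExact i p

variable {A : Type} [Ring A] {X Y Z W : Type} [AddCommGroup X] [Module A X] [AddCommGroup Y]
  [Module A Y] [AddCommGroup Z] [Module A Z] [AddCommGroup W] [Module A W]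

/-- A linear map is null if it factors through a projective module. -/
def NullMap (f : X →ₗ[A] Y) : Prop :=
  ∃ (P : ModuleCat.{0} A) (_ : Module.Projective A P) (g : X →ₗ[A] P) (h : P →ₗ[A] Y), h ∘ₗ g = f

theorem nullMap_comp [Module.Projective A Y] (h : Y →ₗ[A] Z) (g : X →ₗ[A] Y) :
    NullMap (h ∘ₗ g) :=
  ⟨ModuleCat.of A Y, ‹_›, g, h, rfl⟩

theorem NullMap.comp_left {f : X →ₗ[A] Y} (hf : NullMap f) (g : Y →ₗ[A] Z) :
    NullMap (g ∘ₗ f) := by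
  obtain ⟨P, hP, u, v, rfl⟩ := hf
  exact ⟨P, hP, u, g ∘ₗ v, rfl⟩

theorem NullMap.comp_right {f : X →ₗ[A] Y} (hf : NullMap f) (g : Z →ₗ[A] X) :
    NullMap (f ∘ₗ g) := by
  obtain ⟨P, hP, u, v, rfl⟩ := hf
  exact ⟨P, hP, u ∘ₗ g, v, rfl⟩

theorem nullMap_zero : NullMap (0 : X →ₗ[A] Y) :=
  ⟨ModuleCat.of A PUnit, inferInstance, 0, 0, by simp⟩

theorem NullMap.add {f g : X →ₗ[A] Y} (hf : NullMap f) (hg : NullMap g) : NullMap (f + g) := by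
  obtain ⟨P, hP, u, v, rfl⟩ := hf
  obtain ⟨Q, hQ, u', v', rfl⟩ := hg
  exact ⟨ModuleCat.of A (P × Q), inferInstanceAs (Module.Projective A (P × Q)), u.prod u',
    v.coprod v', by ext; simp⟩

theorem NullMap.sum {ι : Type} (s : Finset ι) {f : ι → X →ₗ[A] Y}
    (hf : ∀ i ∈ s, NullMap (f i)) : NullMap (∑ i ∈ s, f i) := by
  classical
  induction s using Finset.induction_on with
  | empty => simpa using nullMap_zero
  | insert a s ha ih =>
    rw [Finset.sum_insert ha]
    exact (hf a (by simp)).add (ih fun i hi => hf i (by simp [hi]))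

theorem NullMap.const_smul {k : Type} [Semiring k] [Module k Y] [SMulCommClass A k Y]
    {f : X →ₗ[A] Y} (hf : NullMap f) (c : k) : NullMap (c • f) := by
  obtain ⟨P, hP, u, v, rfl⟩ := hf
  exact ⟨P, hP, u, c • v, rfl⟩

theorem NullMap.exists_lift {f : X →ₗ[A] Y} (hf : NullMap f) (p : Z →ₗ[A] Y)
    (hp : Function.Surjective p) : ∃ g : X →ₗ[A] Z, NullMap g ∧ p ∘ₗ g = f := by
  obtain ⟨P, hP, u, v, rfl⟩ := hf
  obtain ⟨w, rfl⟩ := Module.projective_lifting_property p v hp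
  exact ⟨w ∘ₗ u, nullMap_comp w u, rfl⟩

theorem exists_extension [ProjectivesInjective A] [Module.Projective A Y] (i : X →ₗ[A] Z)
    (hi : Function.Injective i) (f : X →ₗ[A] Y) : ∃ g : Z →ₗ[A] Y, g ∘ₗ i = f :=
  have := ProjectivesInjective.injective (A := A) Y
  Module.Injective.extension_property A Y _ _ i hi f

theorem NullMap.exists_extension [ProjectivesInjective A] {f : X →ₗ[A] Y} (hf : NullMap f)
    (i : X →ₗ[A] Z) (hi : Function.Injective i) : ∃ g : Z →ₗ[A] Y, g ∘ₗ i = f := by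
  obtain ⟨P, hP, u, v, rfl⟩ := hf
  obtain ⟨w, rfl⟩ := _root_.exists_extension i hi u
  exact ⟨v ∘ₗ w, rfl⟩

variable (A X Y) in
/-- All maps from `X` to `Y` factor through projective modules. -/
def StZero : Prop := ∀ f : X →ₗ[A] Y, NullMap f

theorem StZero.congr_left (h : StZero A X Y) (e : X ≃ₗ[A] Z) : StZero A Z Y := fun f => by
  convert (h (f ∘ₗ e.toLinearMap)).comp_right e.symm.toLinearMap
  ext; simp

theorem StZero.of_retract (h : StZero A X Y) (i : Z →ₗ[A] Y) (p : Y →ₗ[A] Z)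
    (hpi : p ∘ₗ i = LinearMap.id) : StZero A X Z := fun f => by
  convert (h (i ∘ₗ f)).comp_left p
  rw [← LinearMap.comp_assoc, hpi, LinearMap.id_comp]

theorem StZero.congr_right (h : StZero A X Y) (e : Y ≃ₗ[A] Z) : StZero A X Z :=
  h.of_retract e.symm.toLinearMap e.toLinearMap (by ext; simp)

theorem StZero.of_projective_left [Module.Projective A X] : StZero A X Y := fun f => by
  simpa using nullMap_comp f LinearMap.id

theorem StZero.pi {ι : Type} [Fintype ι] {Y : ι → Type} [∀ i, AddCommGroup (Y i)]
    [∀ i, Module A (Y i)] (h : ∀ i, StZero A X (Y i)) : StZero A X (∀ i, Y i) := fun f => by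
  classical
  convert NullMap.sum Finset.univ (f := fun i =>
    LinearMap.single A Y i ∘ₗ LinearMap.proj i ∘ₗ f) fun i _ => (h i _).comp_left _
  ext x i
  simp [Finset.sum_apply]

theorem StZero.of_pi {ι : Type} [Fintype ι] {X : ι → Type} [∀ i, AddCommGroup (X i)]
    [∀ i, Module A (X i)] (h : ∀ i, StZero A (X i) Y) : StZero A (∀ i, X i) Y := fun f => by
  classical
  convert NullMap.sum Finset.univ (f := fun i =>
    (f ∘ₗ LinearMap.single A X i) ∘ₗ LinearMap.proj i) fun i _ => (h i _).comp_right _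
  refine LinearMap.ext fun x => ?_
  simp only [LinearMap.sum_apply, LinearMap.comp_apply, LinearMap.proj_apply,
    LinearMap.single_apply]
  rw [← map_sum, Finset.univ_sum_single]

theorem IsShortExact.stZero {i : X →ₗ[A] Y} {p : Y →ₗ[A] Z} (h : IsShortExact i p)
    (hX : StZero A W X) (hZ : StZero A W Z) : StZero A W Y := fun f => by
  obtain ⟨g, hg, hgf⟩ := (hZ (p ∘ₗ f)).exists_lift p h.surjective
  obtain ⟨d, hd⟩ := i.exists_comp_eq_of_injective h.injective (f - g) fun w => (h.exact _).1 (by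
    have := LinearMap.congr_fun hgf w
    simp only [LinearMap.comp_apply] at this
    simp [this])
  have := ((hX d).comp_left i).add hg
  rwa [hd, sub_add_cancel] at this

/-- Stable Hom groups are invariant under simultaneously passing to syzygies. -/
theorem IsSyzygy.stZero_iff [ProjectivesInjective A] (h : IsSyzygy A X Z) (h' : IsSyzygy A Y W) :
    StZero A X Y ↔ StZero A Z W := by
  obtain ⟨P, hP, i, p, hip⟩ := h
  obtain ⟨I, hI, j, q, hjq⟩ := h'
  constructor
  · intro h f
    obtain ⟨φ, hφ⟩ := Module.projective_lifting_property q (f ∘ₗ p) hjq.surjective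
    obtain ⟨f', hf'⟩ := j.exists_comp_eq_of_injective hjq.injective (φ ∘ₗ i) fun x =>
      (hjq.exact _).1 (by
        have := LinearMap.congr_fun hφ (i x)
        simpa [hip.exact.apply_apply_eq_zero] using this)
    obtain ⟨ψ, hψ⟩ := (h f').exists_extension i hip.injective
    obtain ⟨χ, hχ⟩ := p.exists_comp_eq_of_surjective hip.surjective (φ - j ∘ₗ ψ) fun x hx => by
      obtain ⟨y, rfl⟩ := (hip.exact x).1 hx
      have h1 := LinearMap.congr_fun hf' y
      have h2 := LinearMap.congr_fun hψ y
      simp only [LinearMap.comp_apply] at h1 h2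
      simp [h1, h2]
    convert nullMap_comp q χ
    ext z
    obtain ⟨y, rfl⟩ := hip.surjective z
    have h1 := LinearMap.congr_fun hχ y
    have h2 := LinearMap.congr_fun hφ y
    simp only [LinearMap.comp_apply] at h1 h2
    simp [h1, h2, hjq.exact.apply_apply_eq_zero]
  · intro h f
    obtain ⟨φ, hφ⟩ := exists_extension i hip.injective (j ∘ₗ f)
    obtain ⟨f', hf'⟩ := p.exists_comp_eq_of_surjective hip.surjective (q ∘ₗ φ) fun x hx => by
      obtain ⟨y, rfl⟩ := (hip.exact x).1 hx
      have h1 := LinearMap.congr_fun hφ y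
      simp only [LinearMap.comp_apply] at h1
      simp [h1, hjq.exact.apply_apply_eq_zero]
    obtain ⟨χ, -, hχ⟩ := (h f').exists_lift q hjq.surjective
    obtain ⟨ψ, hψ⟩ := j.exists_comp_eq_of_injective hjq.injective (φ - χ ∘ₗ p) fun x =>
      (hjq.exact _).1 (by
        have h1 := LinearMap.congr_fun hf' x
        have h2 := LinearMap.congr_fun hχ (p x)
        simp only [LinearMap.comp_apply] at h1 h2
        simp [h1, h2])
    convert nullMap_comp ψ i
    ext x
    apply hjq.injective
    have h1 := LinearMap.congr_fun hψ (i x)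
    have h2 := LinearMap.congr_fun hφ x
    simp only [LinearMap.comp_apply] at h1 h2
    simp [h1, h2, hip.exact.apply_apply_eq_zero]

theorem extZero_succ_iff_stZero [ProjectivesInjective A] {K : ℕ → ModuleCat.{0} A}
    (hK : ∀ n, IsSyzygy A (K (n + 1)) (K n)) (n : ℕ) (Y : ModuleCat.{0} A) :
    extZero A (n + 1) (K 0) Y ↔ StZero A (K (n + 1)) Y := by
  choose P hP i p h using hK
  let T : SyzygyTower A K P := ⟨i, p, hP, fun n => (h n).injective, fun n => (h n).surjective,
    fun n => (h n).exact⟩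
  rw [T.extZero_succ_iff]
  refine ⟨fun H f => ?_, fun H f => (H f).exists_extension _ (h n).injective⟩
  obtain ⟨g, rfl⟩ := H f
  have := hP n
  exact nullMap_comp g _

theorem isSyzygy_ker [Module.Projective A X] (p : X →ₗ[A] Y) (hp : Function.Surjective p) :
    IsSyzygy A p.ker Y :=
  ⟨ModuleCat.of A X, ‹_›, p.ker.subtype, p, Subtype.val_injective,
    fun x => by simp, hp⟩

theorem exists_syzygies (Y : ModuleCat.{0} A) :
    ∃ K : ℕ → ModuleCat.{0} A, K 0 = Y ∧ ∀ n, IsSyzygy A (K (n + 1)) (K n) :=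
  ⟨fun n => Nat.rec Y
    (fun _ Z => ModuleCat.of A (Finsupp.linearCombination A (id : Z → Z)).ker) n, rfl,
    fun _ => isSyzygy_ker _ (Finsupp.linearCombination_id_surjective A _)⟩

theorem exists_finite_syzygies [IsNoetherianRing A] (Y : ModuleCat.{0} A) [Module.Finite A Y] :
    ∃ K : ℕ → ModuleCat.{0} A, K 0 = Y ∧ (∀ n, Module.Finite A (K n)) ∧
      ∀ n, IsSyzygy A (K (n + 1)) (K n) := by
  have step : ∀ Z : {Z : ModuleCat.{0} A // Module.Finite A Z},
      ∃ K : {Z : ModuleCat.{0} A // Module.Finite A Z}, IsSyzygy A K.1 Z.1 := by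
    rintro ⟨Z, hZ⟩
    obtain ⟨n, p, hp⟩ := Module.Finite.exists_fin' A Z
    exact ⟨⟨ModuleCat.of A p.ker, inferInstanceAs (Module.Finite A p.ker)⟩, isSyzygy_ker p hp⟩
  choose s hs using step
  let K : ℕ → {Z : ModuleCat.{0} A // Module.Finite A Z} := fun n =>
    Nat.rec ⟨Y, ‹_›⟩ (fun _ Z => s Z) n
  exact ⟨fun n => (K n).1, rfl, fun n => (K n).2, fun n => hs (K n)⟩

end NullMaps

/-! ## Duality between stable maps via the Nakayama functor -/

section NakayamaDuality

theorem LinearMap.exists_dual_comp_eq {k U V : Type} [Field k] [AddCommGroup U] [Module k U]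
    [AddCommGroup V] [Module k V] (T : U →ₗ[k] V) (μ : U →ₗ[k] k)
    (h : ∀ u, T u = 0 → μ u = 0) : ∃ l : V →ₗ[k] k, l ∘ₗ T = μ := by
  have : μ ∈ LinearMap.range T.dualMap := by
    rw [LinearMap.range_dualMap_eq_dualAnnihilator_ker, Submodule.mem_dualAnnihilator]
    exact h
  exact this

theorem exists_dual_basis (A : Type) [Ring A] (P : Type) [AddCommGroup P] [Module A P]
    [Module.Finite A P] [Module.Projective A P] :
    ∃ (n : ℕ) (x : Fin n → P) (φ : Fin n → P →ₗ[A] A), ∀ z, ∑ j, φ j z • x j = z := by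
  obtain ⟨n, π, hπ⟩ := Module.Finite.exists_fin' A P
  obtain ⟨s, hs⟩ := π.exists_rightInverse_of_surjective (LinearMap.range_eq_top.2 hπ)
  refine ⟨n, fun j => π (fun i => if j = i then 1 else 0), fun j => LinearMap.proj j ∘ₗ s, fun z => ?_⟩
  have := LinearMap.congr_fun hs z
  rw [LinearMap.comp_apply, LinearMap.pi_apply_eq_sum_univ π] at this
  simpa using this

variable {k A : Type} [Field k] [Ring A] [Algebra k A]

instance (X : Type) [AddCommGroup X] [Module A X] : IsScalarTower k A (NuCarrier k A X) :=
  ⟨fun c a φ => LinearMap.ext fun f => by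
    change φ (rmulHom k A X (c • a) f) = c • φ (rmulHom k A X a f)
    rw [← map_smul]
    exact congrArg φ (by ext; simp)⟩

theorem nuCarrier_smul_apply {X : Type} [AddCommGroup X] [Module A X] (a : A)
    (φ : NuCarrier k A X) (f : X →ₗ[A] A) : (a • φ) f = φ (rmulHom k A X a f) := rfl

variable {X Y Z W : Type} [AddCommGroup X] [Module A X] [AddCommGroup Y] [Module A Y]
  [AddCommGroup Z] [Module A Z] [AddCommGroup W] [Module A W]

variable (k) in
/-- The action of the Nakayama functor on morphisms. -/
def nuMap (f : X →ₗ[A] Z) : NuCarrier k A X →ₗ[A] NuCarrier k A Z where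
  toFun ψ := ψ ∘ₗ LinearMap.lcomp k A f
  map_add' _ _ := rfl
  map_smul' _ _ := rfl

theorem nuMap_apply (f : X →ₗ[A] Z) (ψ : NuCarrier k A X) (φ : Z →ₗ[A] A) :
    nuMap k f ψ φ = ψ (φ ∘ₗ f) := rfl

theorem nuMap_surjective (f : X →ₗ[A] Z) (hf : Function.Surjective f) :
    Function.Surjective (nuMap k f) := fun ψ =>
  LinearMap.exists_dual_comp_eq (LinearMap.lcomp k A f) ψ fun φ hφ => by
    rw [show φ = 0 from LinearMap.ext fun z => by
      obtain ⟨x, rfl⟩ := hf z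
      exact LinearMap.congr_fun hφ x, map_zero]

theorem nuMap_injective [Module.Injective A A] (f : X →ₗ[A] Z) (hf : Function.Injective f) :
    Function.Injective (nuMap k f) := fun ψ ψ' h => LinearMap.ext fun φ => by
  obtain ⟨g, rfl⟩ := Module.Injective.extension_property A A _ _ f hf φ
  exact LinearMap.congr_fun h g

variable [Module k Y] [IsScalarTower k A Y] [Module k W] [IsScalarTower k A W]

/-- The canonical map `D Hom_A(Z, Y) → Hom_A(Y, ν Z)`. -/
def nuAdjoint (l : (Z →ₗ[A] Y) →ₗ[k] k) : Y →ₗ[A] NuCarrier k A Z where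
  toFun y :=
    { toFun := fun φ => l (φ.smulRight y)
      map_add' := fun φ φ' => by
        rw [← map_add]
        exact congrArg l (by ext; simp [add_smul])
      map_smul' := fun c φ => by
        rw [RingHom.id_apply, ← map_smul]
        exact congrArg l (by ext; simp) }
  map_add' y y' := LinearMap.ext fun φ => by
    change l _ = l _ + l _
    rw [← map_add]
    exact congrArg l (by ext; simp)
  map_smul' a y := LinearMap.ext fun φ => by
    change l _ = l _
    exact congrArg l (by ext; simp [mul_smul])

theorem nuAdjoint_apply (l : (Z →ₗ[A] Y) →ₗ[k] k) (y : Y) (φ : Z →ₗ[A] A) :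
    nuAdjoint l y φ = l (φ.smulRight y) := rfl

theorem nuAdjoint_comp_lcomp (f : X →ₗ[A] Z) (l : (X →ₗ[A] Y) →ₗ[k] k) :
    nuAdjoint (l ∘ₗ LinearMap.lcomp k Y f) = nuMap k f ∘ₗ nuAdjoint l := rfl

theorem nuAdjoint_surjective [Module.Finite A Z] [Module.Projective A Z]
    (g : Y →ₗ[A] NuCarrier k A Z) : ∃ l : (Z →ₗ[A] Y) →ₗ[k] k, nuAdjoint l = g := by
  obtain ⟨n, x, φ, hx⟩ := exists_dual_basis A Z
  refine ⟨
    { toFun := fun h => ∑ j, g (h (x j)) (φ j)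
      map_add' := fun h h' => by simp [Finset.sum_add_distrib]
      map_smul' := fun c h => by
        simp only [LinearMap.smul_apply, RingHom.id_apply, Finset.smul_sum]
        refine Finset.sum_congr rfl fun j _ => ?_
        rw [← algebraMap_smul A c, map_smul, algebraMap_smul, LinearMap.smul_apply] }, ?_⟩
  refine LinearMap.ext fun y => LinearMap.ext fun ψ => ?_
  change ∑ j, g (ψ (x j) • y) (φ j) = g y ψ
  simp only [map_smul, nuCarrier_smul_apply]
  rw [← map_sum]
  refine congrArg (g y) (LinearMap.ext fun z => ?_)
  rw [LinearMap.sum_apply]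
  conv_rhs => rw [← hx z, map_sum]
  simp

theorem span_smulRight_eq_top_iff (k : Type) {A : Type} [Field k] [Ring A] [Algebra k A]
    [FiniteDimensional k A] [Module.Injective A A] [ProjectivesInjective A] {Y Z : Type}
    [AddCommGroup Y] [Module A Y] [AddCommGroup Z] [Module A Z] [Module k Y]
    [IsScalarTower k A Y] [Module.Finite A Z] :
    Submodule.span k {f : Z →ₗ[A] Y | ∃ φ : Z →ₗ[A] A, ∃ y, φ.smulRight y = f} = ⊤ ↔
      StZero A Z Y := by
  constructor
  · intro h f
    have hf : f ∈ Submodule.span k {f : Z →ₗ[A] Y | ∃ φ : Z →ₗ[A] A, ∃ y, φ.smulRight y = f} :=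
      h ▸ Submodule.mem_top
    induction hf using Submodule.span_induction with
    | mem f hf =>
      obtain ⟨φ, y, rfl⟩ := hf
      exact nullMap_comp (LinearMap.toSpanSingleton A Y y) φ
    | zero => exact nullMap_zero
    | add f g _ _ hf hg => exact hf.add hg
    | smul c f _ hf => exact hf.const_smul c
  · rw [eq_top_iff]
    rintro h f -
    obtain ⟨n, i, hi⟩ := exists_injective_to_free k A Z
    obtain ⟨g, rfl⟩ := (h f).exists_extension i hi
    have : g ∘ₗ i = ∑ j, (LinearMap.proj j ∘ₗ i).smulRight (g fun i => if j = i then 1 else 0) := by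
      ext z
      simp [LinearMap.pi_apply_eq_sum_univ g (i z)]
    rw [this]
    exact Submodule.sum_mem _ fun j _ => Submodule.subset_span ⟨_, _, rfl⟩

theorem stZero_iff_nuAdjoint (k : Type) {A : Type} [Field k] [Ring A] [Algebra k A]
    [FiniteDimensional k A] [Module.Injective A A] [ProjectivesInjective A] {Y Z : Type}
    [AddCommGroup Y] [Module A Y] [AddCommGroup Z] [Module A Z] [Module k Y]
    [IsScalarTower k A Y] [Module.Finite A Z] :
    StZero A Z Y ↔ ∀ l : (Z →ₗ[A] Y) →ₗ[k] k, nuAdjoint l = 0 → l = 0 := by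
  rw [← span_smulRight_eq_top_iff k]
  constructor
  · intro h l hl
    refine LinearMap.ext_on h ?_
    rintro _ ⟨φ, y, rfl⟩
    exact LinearMap.congr_fun (LinearMap.congr_fun hl y) φ
  · intro h
    by_contra hne
    obtain ⟨f, -, hf⟩ := SetLike.exists_of_lt (lt_top_iff_ne_top.2 hne)
    obtain ⟨l, hlf, hl⟩ := Submodule.exists_le_ker_of_notMem hf
    apply hlf
    rw [h l (LinearMap.ext fun y => LinearMap.ext fun φ =>
      hl (Submodule.subset_span ⟨φ, y, rfl⟩)), LinearMap.zero_apply]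

theorem projective_nuCarrier (k : Type) {A : Type} [Field k] [Ring A] [Algebra k A]
    [FiniteDimensional k A] [Module.Injective A A] (P : Type) [AddCommGroup P] [Module A P]
    [Module.Finite A P] [Module.Projective A P] : Module.Projective A (NuCarrier k A P) := by
  let := restrictModule k A P
  have := restrictModule_isScalarTower k A P
  have : Module.Finite k P := Module.Finite.trans A P
  have : Module.Finite A (NuCarrier k A P) := Module.Finite.of_restrictScalars_finite k A _
  have : Module.Injective A (NuCarrier k A P) := ⟨fun U V _ _ _ _ f hf g => by
    let := restrictModule k A U
    have := restrictModule_isScalarTower k A U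
    let := restrictModule k A V
    have := restrictModule_isScalarTower k A V
    obtain ⟨l, rfl⟩ := nuAdjoint_surjective g
    let T : (P →ₗ[A] U) →ₗ[k] (P →ₗ[A] V) :=
      { toFun := fun h => f ∘ₗ h
        map_add' := fun h h' => LinearMap.comp_add _ _ _
        map_smul' := fun c h => LinearMap.ext fun x => by
          simp only [LinearMap.comp_apply, LinearMap.smul_apply, RingHom.id_apply]
          rw [← algebraMap_smul A c, map_smul, algebraMap_smul] }
    obtain ⟨l', hl'⟩ := LinearMap.exists_dual_comp_eq T l fun h hh => by
      rw [show h = 0 from LinearMap.ext fun x => hf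
        ((LinearMap.congr_fun hh x).trans (map_zero f).symm), map_zero]
    refine ⟨nuAdjoint l', fun x => LinearMap.ext fun φ => ?_⟩
    rw [← hl']
    exact congrArg l' (by ext; simp [T])⟩
  exact projective_of_injective_of_finite k A _

theorem nullMap_nuCarrier_iff (k : Type) {A : Type} [Field k] [Ring A] [Algebra k A]
    [FiniteDimensional k A] [Module.Injective A A] {Y Z : Type}
    [AddCommGroup Y] [Module A Y] [AddCommGroup Z] [Module A Z] [Module k Y]
    [IsScalarTower k A Y] [Module.Finite A Z] (f : Y →ₗ[A] NuCarrier k A Z) :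
    NullMap f ↔ ∃ l : (Z →ₗ[A] Y) →ₗ[k] k, nuAdjoint l = f := by
  obtain ⟨n, π, hπ⟩ := Module.Finite.exists_fin' A Z
  have := projective_nuCarrier k (A := A) (Fin n → A)
  constructor
  · intro hf
    obtain ⟨g, -, rfl⟩ := hf.exists_lift (nuMap k π) (nuMap_surjective π hπ)
    obtain ⟨l, rfl⟩ := nuAdjoint_surjective g
    exact ⟨_, nuAdjoint_comp_lcomp π l⟩
  · rintro ⟨l, rfl⟩
    obtain ⟨l', rfl⟩ := LinearMap.exists_dual_comp_eq (LinearMap.lcomp k Y π) l fun h hh => by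
      rw [show h = 0 from LinearMap.ext fun z => by
        obtain ⟨x, rfl⟩ := hπ z
        exact LinearMap.congr_fun hh x, map_zero]
    rw [nuAdjoint_comp_lcomp]
    exact nullMap_comp _ _

/-- A form of Auslander–Reiten duality: if `0 → C → I → C' → 0` is exact with `C`, `I` finitely
generated and `I` projective, then all maps from `C'` to `Y` are null iff all maps from `Y` to
`ν C` are null. -/
theorem stZero_iff_stZero_nuCarrier (k : Type) {A : Type} [Field k] [Ring A] [Algebra k A]
    [FiniteDimensional k A] [Module.Injective A A] [ProjectivesInjective A] {C I C' : Type}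
    [AddCommGroup C] [Module A C] [AddCommGroup I] [Module A I] [AddCommGroup C'] [Module A C']
    [Module.Finite A C] [Module.Finite A I] [Module.Projective A I] {i : C →ₗ[A] I}
    {p : I →ₗ[A] C'} (h : IsShortExact i p) (Y : Type) [AddCommGroup Y] [Module A Y] :
    StZero A C' Y ↔ StZero A Y (NuCarrier k A C) := by
  let := restrictModule k A Y
  have := restrictModule_isScalarTower k A Y
  have : Module.Finite A C' := Module.Finite.of_surjective p h.surjective
  have hpi : p ∘ₗ i = 0 := LinearMap.ext h.exact.apply_apply_eq_zero
  rw [stZero_iff_nuAdjoint k]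
  constructor
  · intro H f
    rw [nullMap_nuCarrier_iff]
    obtain ⟨μ, hμ⟩ := nuAdjoint_surjective (nuMap k i ∘ₗ f)
    have hμp := H (μ ∘ₗ LinearMap.lcomp k Y p) (by
      rw [nuAdjoint_comp_lcomp, hμ]
      refine LinearMap.ext fun y => LinearMap.ext fun φ => ?_
      simp only [LinearMap.comp_apply, nuMap_apply, LinearMap.comp_assoc, hpi]
      simp)
    obtain ⟨l, rfl⟩ := LinearMap.exists_dual_comp_eq (LinearMap.lcomp k Y i) μ fun g hg => by
      obtain ⟨g', rfl⟩ := p.exists_comp_eq_of_surjective h.surjective g fun x hx => by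
        obtain ⟨y, rfl⟩ := (h.exact x).1 hx
        exact LinearMap.congr_fun hg y
      exact LinearMap.congr_fun hμp g'
    refine ⟨l, LinearMap.ext fun y => nuMap_injective i h.injective ?_⟩
    rw [nuAdjoint_comp_lcomp] at hμ
    exact LinearMap.congr_fun hμ y
  · intro H l hl
    obtain ⟨μ, rfl⟩ := LinearMap.exists_dual_comp_eq (LinearMap.lcomp k Y p) l fun g hg => by
      rw [show g = 0 from LinearMap.ext fun z => by
        obtain ⟨x, rfl⟩ := h.surjective z
        exact LinearMap.congr_fun hg x, map_zero]
    rw [nuAdjoint_comp_lcomp] at hl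
    obtain ⟨f, hf⟩ := (nuMap k i).exists_comp_eq_of_injective (nuMap_injective i h.injective)
      (nuAdjoint μ) fun y => LinearMap.exists_dual_comp_eq (LinearMap.lcomp k A i)
        (nuAdjoint μ y) fun g hg => by
          obtain ⟨g', rfl⟩ := p.exists_comp_eq_of_surjective h.surjective g fun x hx => by
            obtain ⟨y, rfl⟩ := (h.exact x).1 hx
            exact LinearMap.congr_fun hg y
          exact LinearMap.congr_fun (LinearMap.congr_fun hl y) g'
    obtain ⟨l', rfl⟩ := (nullMap_nuCarrier_iff k f).1 (H f)
    rw [← nuAdjoint_comp_lcomp] at hf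
    have hμ : μ = l' ∘ₗ LinearMap.lcomp k Y i := by
      rw [← sub_eq_zero]
      refine (stZero_iff_nuAdjoint k).1 StZero.of_projective_left _ ?_
      refine LinearMap.ext fun y => LinearMap.ext fun φ => ?_
      rw [nuAdjoint_apply, LinearMap.sub_apply]
      exact sub_eq_zero.2 (LinearMap.congr_fun (LinearMap.congr_fun hf y) φ).symm
    refine LinearMap.ext fun g => ?_
    rw [hμ]
    simp only [LinearMap.comp_apply, LinearMap.lcomp_apply', LinearMap.comp_assoc, hpi]
    simp

end NakayamaDuality

/-! ## Cosyzygies of a self-orthogonal Nakayama-stable generator -/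

section Cosyzygies

variable {A : Type} [Ring A]

theorem StZero.of_memAdd {M X : ModuleCat.{0} A} (h : MemAdd A M X) {Y : Type} [AddCommGroup Y]
    [Module A Y] (hY : StZero A Y M) : StZero A Y X := by
  obtain ⟨n, X', ⟨e⟩⟩ := h
  refine (StZero.pi (Y := fun _ : Fin n => M) fun _ => hY).of_retract
    (e.toLinearMap ∘ₗ LinearMap.inl A X X') (LinearMap.fst A X X' ∘ₗ e.symm.toLinearMap) ?_
  ext; simp

theorem memAdd_self (M : ModuleCat.{0} A) : MemAdd A M M :=
  ⟨1, ModuleCat.of A PUnit,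
    ⟨(LinearEquiv.prodUnique (R := A) (M := M) (M₂ := PUnit)).trans
      (LinearEquiv.funUnique (Fin 1) A M).symm⟩⟩

theorem NakayamaStable.stZero_iff {k : Type} [Field k] [Algebra k A] {M : ModuleCat.{0} A}
    (h : NakayamaStable k A M) (Y : Type) [AddCommGroup Y] [Module A Y] :
    StZero A Y (NuCarrier k A M) ↔ StZero A Y M :=
  ⟨StZero.of_memAdd (M := NuMod k A M) ((h M).1 (memAdd_self M)),
    StZero.of_memAdd (X := NuMod k A M) ((h _).2 (memAdd_self _))⟩

theorem IsInjEnvelope.finite (k : Type) {A : Type} [Field k] [Ring A] [Algebra k A]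
    [FiniteDimensional k A] [Module.Injective A A] [ProjectivesInjective A]
    {N I : ModuleCat.{0} A} [Module.Finite A N] {ι : N ⟶ I} (h : IsInjEnvelope A ι) :
    Module.Finite A I := by
  have : IsNoetherianRing A := isNoetherian_of_tower k inferInstance
  obtain ⟨n, e, he⟩ := exists_injective_to_free k A N
  obtain ⟨g, hg⟩ := exists_extension ι.hom h.2.1 e
  refine Module.Finite.of_injective g (LinearMap.ker_eq_bot.1 (h.2.2 _ ?_))
  rw [eq_bot_iff]
  rintro _ ⟨hx, y, rfl⟩
  rw [show y = 0 from he (by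
    rw [← hg, map_zero]
    exact hx), map_zero]
  exact Submodule.zero_mem _

/-- A projective embedding of a finitely generated module together with its cokernel. -/
def HasFiniteCosyzygy (A C C' : Type) [Ring A] [AddCommGroup C] [Module A C] [AddCommGroup C']
    [Module A C'] : Prop :=
  ∃ (I : ModuleCat.{0} A) (_ : Module.Finite A I) (_ : Module.Projective A I) (i : C →ₗ[A] I)
    (p : I →ₗ[A] C'), IsShortExact i p

theorem HasFiniteCosyzygy.isSyzygy {C C' : Type} [AddCommGroup C] [Module A C]
    [AddCommGroup C'] [Module A C'] (h : HasFiniteCosyzygy A C C') : IsSyzygy A C C' := by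
  obtain ⟨I, -, hI, i, p, h⟩ := h
  exact ⟨I, hI, i, p, h⟩

theorem IsMinInjCoresolution.finite_and_hasFiniteCosyzygy (k : Type) {A : Type} [Field k] [Ring A]
    [Algebra k A] [FiniteDimensional k A] [Module.Injective A A] [ProjectivesInjective A]
    {M : ModuleCat.{0} A} [Module.Finite A M] {C : ℕ → ModuleCat.{0} A}
    (hC : IsMinInjCoresolution A M C) (n : ℕ) :
    Module.Finite A (C n) ∧ HasFiniteCosyzygy A (C n) (C (n + 1)) := by
  have step : ∀ n, Module.Finite A (C n) →
      Module.Finite A (C (n + 1)) ∧ HasFiniteCosyzygy A (C n) (C (n + 1)) := by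
    intro n hn
    obtain ⟨I, ι, p, hι, hp, hιp⟩ := hC.2 n
    have := hι.finite k
    have := hι.1
    exact ⟨Module.Finite.of_surjective p.hom hp, I, ‹_›,
      projective_of_injective_of_finite k A I, ι.hom, p.hom, hι.2.1,
      LinearMap.exact_iff.2 hιp.symm, hp⟩
  have fin : ∀ n, Module.Finite A (C n) := by
    intro n
    induction n with
    | zero => exact Module.Finite.equiv hC.1.some.symm.toLinearEquiv
    | succ n ih => exact (step n ih).1
  exact ⟨fin n, (step n (fin n)).2⟩

/-- The properties of the sequence of cosyzygies of a self-orthogonal Nakayama-stable module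
over a self-injective algebra. -/
structure OrthogonalCosyzygies (A : Type) [Ring A] (M : ModuleCat.{0} A)
    (C : ℕ → ModuleCat.{0} A) : Prop where
  finite : ∀ n, Module.Finite A (C n)
  hasFiniteCosyzygy : ∀ n, HasFiniteCosyzygy A (C n) (C (n + 1))
  equiv : Nonempty (C 0 ≃ₗ[A] M)
  stZero_of_lt : ∀ a b, a < b → StZero A (C a) (C b)
  extZero_left_iff : ∀ (j : ℕ) (Y : ModuleCat.{0} A),
    extZero A (j + 1) Y M ↔ StZero A (C (j + 2)) Y
  stZero_one_iff : ∀ Y : ModuleCat.{0} A, StZero A (C 1) Y ↔ StZero A Y M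
  extZero_right_iff : ∃ K : ℕ → ModuleCat.{0} A, (∀ n, Module.Finite A (K n)) ∧
    (∀ n i, StZero A (K n) (C i)) ∧ ∀ n Y, extZero A (n + 1) M Y ↔ StZero A (K n) Y

theorem IsMinInjCoresolution.orthogonalCosyzygies (k : Type) {A : Type} [Field k] [Ring A]
    [Algebra k A] [FiniteDimensional k A] [Module.Injective A A] [ProjectivesInjective A]
    {M : ModuleCat.{0} A} [Module.Finite A M] (hso : SelfOrthogonal A M)
    (hns : NakayamaStable k A M) {C : ℕ → ModuleCat.{0} A}
    (hC : IsMinInjCoresolution A M C) : OrthogonalCosyzygies A M C := by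
  have : IsNoetherianRing A := isNoetherian_of_tower k inferInstance
  have hfin := fun n => (hC.finite_and_hasFiniteCosyzygy k n).1
  have hcos := fun n => (hC.finite_and_hasFiniteCosyzygy k n).2
  have hsyz := fun n => (hcos n).isSyzygy
  let e : C 0 ≃ₗ[A] M := hC.1.some.toLinearEquiv
  obtain ⟨K, rfl, hKfin, hK⟩ := exists_finite_syzygies M
  have hKC : ∀ i j, 1 ≤ i + j → StZero A (K j) (C i) := by
    intro i
    induction i with
    | zero =>
      intro j hj
      obtain ⟨j, rfl⟩ : ∃ j', j = j' + 1 := ⟨j - 1, by lia⟩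
      exact ((extZero_succ_iff_stZero hK j (K 0)).1 (hso _ (by lia))).congr_right e.symm
    | succ i ih =>
      intro j _
      exact ((hK j).stZero_iff (hsyz i)).1 (ih (j + 1) (by lia))
  have hone : ∀ Y : ModuleCat.{0} A, StZero A (C 1) Y ↔ StZero A Y (K 0) := by
    intro Y
    obtain ⟨I, _, _, i, p, h⟩ := hcos 0
    rw [← hns.stZero_iff, stZero_iff_stZero_nuCarrier k (i := i ∘ₗ e.symm.toLinearMap) (p := p)]
    refine ⟨h.injective.comp e.symm.injective, fun x => ?_, h.surjective⟩
    rw [h.exact x]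
    exact ⟨fun ⟨y, hy⟩ => ⟨e y, by simpa using hy⟩, fun ⟨y, hy⟩ => ⟨e.symm y, by simpa using hy⟩⟩
  refine ⟨hfin, hcos, ⟨e⟩, ?_, ?_, hone, fun n => K (n + 1), fun n => hKfin _,
    fun n i => hKC _ _ (by lia), fun n Y => extZero_succ_iff_stZero hK n Y⟩
  · intro a
    induction a with
    | zero => exact fun b hb => (hKC b 0 (by lia)).congr_left e.symm
    | succ a ih =>
      intro b hb
      obtain ⟨b, rfl⟩ : ∃ b', b = b' + 1 := ⟨b - 1, by lia⟩
      exact ((hsyz a).stZero_iff (hsyz b)).1 (ih b (by lia))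
  · intro j Y
    obtain ⟨L, rfl, hL⟩ := exists_syzygies Y
    have shift : ∀ a b, StZero A (C a) (L b) ↔ StZero A (C (a + b)) (L 0) := by
      intro a b
      induction b generalizing a with
      | zero => rfl
      | succ b ih => rw [(hsyz a).stZero_iff (hL b), ih, add_assoc, add_comm 1 b]
    rw [extZero_succ_iff_stZero hL, ← hone, shift, add_comm 1]

end Cosyzygies

/-! ## Unions of chains of modules -/

section Chains

variable {A : Type} [Ring A]

theorem exists_union_of_chain (X : ℕ → ModuleCat.{0} A) (s : ∀ n, X n →ₗ[A] X (n + 1))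
    (hs : ∀ n, Function.Injective (s n)) :
    ∃ (L : ModuleCat.{0} A) (ι : ∀ n, X n →ₗ[A] L), (∀ n, Function.Injective (ι n)) ∧
      (∀ n, ι (n + 1) ∘ₗ s n = ι n) ∧ ∀ x, ∃ n y, ι n y = x := by
  let g : ∀ i j, i ≤ j → X i →ₗ[A] X j := fun i j h =>
    Nat.leRecOn (C := fun j => X i →ₗ[A] X j) h (fun {j} φ => s j ∘ₗ φ) LinearMap.id
  have g_self : ∀ i h, g i i h = LinearMap.id := fun i _ => Nat.leRecOn_self _
  have g_succ : ∀ i j (h : i ≤ j), g i (j + 1) (h.trans (Nat.le_succ j)) = s j ∘ₗ g i j h :=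
    fun i j h => Nat.leRecOn_succ h _
  have g_trans : ∀ i j l (hij : i ≤ j) (hjl : j ≤ l), g j l hjl ∘ₗ g i j hij =
      g i l (hij.trans hjl) := by
    intro i j l hij hjl
    induction l, hjl using Nat.le_induction with
    | base => rw [g_self, LinearMap.id_comp]
    | succ l hl ih => rw [g_succ j l hl, LinearMap.comp_assoc, ih, g_succ i l (hij.trans hl)]
  have g_inj : ∀ i j (h : i ≤ j), Function.Injective (g i j h) := by
    intro i j h
    induction j, h using Nat.le_induction with
    | base => rw [g_self]; exact Function.injective_id
    | succ j hj ih => rw [g_succ i j hj]; exact (hs j).comp ih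
  have : DirectedSystem (fun n => X n) (g · · ·) :=
    ⟨fun i x => by rw [g_self]; rfl, fun i j l hij hjl x =>
      LinearMap.congr_fun (g_trans _ _ _ _ _) x⟩
  refine ⟨ModuleCat.of A (Module.DirectLimit (fun n => X n) g),
    fun n => Module.DirectLimit.of A ℕ (fun n => X n) g n, fun n => ?_, fun n => ?_, fun x => ?_⟩
  · rw [injective_iff_map_eq_zero]
    intro x hx
    obtain ⟨j, hj, h⟩ := Module.DirectLimit.of.zero_exact hx
    exact g_inj _ _ hj (h.trans (map_zero _).symm)
  · ext x
    have h := g_succ n n le_rfl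
    rw [g_self, LinearMap.comp_id] at h
    rw [← h]
    exact Module.DirectLimit.of_f
  · exact Module.DirectLimit.exists_of x

variable {X Y Z P : Type} [AddCommGroup X] [Module A X] [AddCommGroup Y] [Module A Y]
  [AddCommGroup Z] [Module A Z] [AddCommGroup P] [Module A P]

theorem exists_forall_mem_of_finite [Module.Finite A Z] {F : ℕ → Submodule A X}
    (hF : Monotone F) (htop : ⨆ n, F n = ⊤) (f : Z →ₗ[A] X) : ∃ n, ∀ z, f z ∈ F n := by
  obtain ⟨r, x, hx⟩ := Module.Finite.exists_fin (R := A) (M := Z)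
  have hmem : ∀ y : X, ∃ n, y ∈ F n := fun y =>
    (Submodule.mem_iSup_of_directed F hF.directed_le).1 (htop ▸ Submodule.mem_top)
  choose N hN using fun j => hmem (f (x j))
  refine ⟨Finset.univ.sup N, fun z => ?_⟩
  have hle : Submodule.span A (Set.range x) ≤ (F (Finset.univ.sup N)).comap f := by
    rw [Submodule.span_le]
    rintro _ ⟨j, rfl⟩
    exact hF (Finset.le_sup (Finset.mem_univ j)) (hN j)
  exact hle (hx ▸ Submodule.mem_top)

/-- A sequence of maps which is eventually constant on every element of a filtered module glues
to a linear map. -/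
theorem exists_glue {F : ℕ → Submodule A X} (hF : Monotone F) (htop : ⨆ n, F n = ⊤)
    (l : ℕ → X →ₗ[A] P) (hl : ∀ n, ∀ x ∈ F n, l (n + 1) x = l n x) :
    ∃ L : X →ₗ[A] P, ∀ n, ∀ x ∈ F n, L x = l n x := by
  have hmem : ∀ y : X, ∃ n, y ∈ F n := fun y =>
    (Submodule.mem_iSup_of_directed F hF.directed_le).1 (htop ▸ Submodule.mem_top)
  have const : ∀ n m, n ≤ m → ∀ x ∈ F n, l m x = l n x := by
    intro n m h x hx
    induction m, h using Nat.le_induction with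
    | base => rfl
    | succ m hm ih => rw [hl m x (hF hm hx), ih]
  choose N hN using hmem
  have key : ∀ n, ∀ x ∈ F n, l (N x) x = l n x := by
    intro n x hx
    rcases le_total n (N x) with h | h
    · exact const _ _ h x hx
    · exact (const _ _ h x (hN x)).symm
  refine ⟨⟨⟨fun x => l (N x) x, fun x y => ?_⟩, fun a x => ?_⟩, key⟩
  · have hx := hF (le_max_left (N x) (N y)) (hN x)
    have hy := hF (le_max_right (N x) (N y)) (hN y)
    rw [key _ x hx, key _ y hy, key _ _ (Submodule.add_mem _ hx hy), map_add]
  · change l (N (a • x)) (a • x) = a • l (N x) x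
    rw [key _ _ (Submodule.smul_mem _ a (hN x)), map_smul]

/-- A map out of a filtered module which vanishes on the bottom of the filtration is null if all
maps out of the subquotients are null. -/
theorem nullMap_of_filtration [ProjectivesInjective A] {F : ℕ → Submodule A X} (hF : Monotone F)
    (htop : ⨆ n, F n = ⊤)
    (hgr : ∀ n, StZero A (↥(F (n + 1)) ⧸ (Submodule.comap (F (n + 1)).subtype (F n))) Y)
    (f : X →ₗ[A] Y) (hf : ∀ x ∈ F 0, f x = 0) : NullMap f := by
  let q : (Y →₀ A) →ₗ[A] Y := Finsupp.linearCombination A id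
  have hq : Function.Surjective q := Finsupp.linearCombination_id_surjective A Y
  have step : ∀ (n : ℕ) (l : {l : X →ₗ[A] (Y →₀ A) // ∀ x ∈ F n, q (l x) = f x}),
      ∃ l' : {l : X →ₗ[A] (Y →₀ A) // ∀ x ∈ F (n + 1), q (l x) = f x},
        ∀ x ∈ F n, l'.1 x = l.1 x := by
    rintro n ⟨l, hl⟩
    obtain ⟨d, hd⟩ := (Submodule.comap (F (n + 1)).subtype (F n)).mkQ.exists_comp_eq_of_surjective
      (Submodule.mkQ_surjective _) ((f - q ∘ₗ l) ∘ₗ (F (n + 1)).subtype) fun x hx => by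
        rw [Submodule.mkQ_apply, Submodule.Quotient.mk_eq_zero] at hx
        simp [hl x hx]
    obtain ⟨d', -, hd'⟩ := (hgr n d).exists_lift q hq
    obtain ⟨g, hg⟩ := exists_extension (F (n + 1)).subtype (Submodule.injective_subtype _)
      (d' ∘ₗ Submodule.mkQ _)
    refine ⟨⟨l + g, fun x hx => ?_⟩, fun x hx => ?_⟩
    · have h1 := LinearMap.congr_fun hg ⟨x, hx⟩
      have h2 := LinearMap.congr_fun hd ⟨x, hx⟩
      rw [← hd'] at h2
      simp only [LinearMap.comp_apply, Submodule.subtype_apply, LinearMap.sub_apply] at h1 h2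
      rw [LinearMap.add_apply, map_add, h1, h2, add_sub_cancel]
    · have h1 := LinearMap.congr_fun hg ⟨x, hF n.le_succ hx⟩
      simp only [LinearMap.comp_apply, Submodule.subtype_apply] at h1
      have h2 : (Submodule.comap (F (n + 1)).subtype (F n)).mkQ ⟨x, hF n.le_succ hx⟩ = 0 :=
        (Submodule.Quotient.mk_eq_zero _).2 hx
      rw [LinearMap.add_apply, h1, h2, map_zero, add_zero]
  choose next hnext using step
  let l : ∀ n, {l : X →ₗ[A] (Y →₀ A) // ∀ x ∈ F n, q (l x) = f x} := fun n =>
    Nat.rec ⟨0, fun x hx => by rw [hf x hx, LinearMap.zero_apply, map_zero]⟩ next n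
  obtain ⟨L, hL⟩ := exists_glue hF htop (fun n => (l n).1) fun n x hx => hnext n (l n) x hx
  convert nullMap_comp q L
  ext x
  obtain ⟨n, hn⟩ := (Submodule.mem_iSup_of_directed F hF.directed_le).1
    (htop ▸ Submodule.mem_top : x ∈ ⨆ n, F n)
  rw [LinearMap.comp_apply, hL n x hn, (l n).2 x hn]

theorem isShortExact_inclusion {N N' : Submodule A X} (h : N ≤ N') {q : N' →ₗ[A] Y}
    (hq : Function.Surjective q) (hker : q.ker = N.comap N'.subtype) :
    IsShortExact (Submodule.inclusion h) q := by
  refine ⟨Submodule.inclusion_injective h, fun x => ?_, hq⟩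
  rw [← LinearMap.mem_ker, hker]
  exact ⟨fun hx => ⟨⟨x, hx⟩, rfl⟩, fun ⟨y, hy⟩ => hy ▸ y.2⟩

end Chains

/-! ## Universal extensions killing the maps out of a module -/

section UniversalExtension

theorem exists_extension_killing (k : Type) {A : Type} [Field k] [Ring A] [Algebra k A]
    [FiniteDimensional k A] {C C' : Type} [AddCommGroup C] [Module A C] [AddCommGroup C']
    [Module A C'] [Module.Finite A C] (h : HasFiniteCosyzygy A C C') (X : Type)
    [AddCommGroup X] [Module A X] [Module.Finite A X] :
    ∃ (X' : ModuleCat.{0} A) (_ : Module.Finite A X') (s : X →ₗ[A] X') (m : ℕ)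
      (q : X' →ₗ[A] (Fin m → C')), IsShortExact s q ∧ ∀ f : C →ₗ[A] X, NullMap (s ∘ₗ f) := by
  obtain ⟨I, _, _, i, p, h⟩ := h
  let := restrictModule k A X
  have := restrictModule_isScalarTower k A X
  have : Module.Finite k X := Module.Finite.trans A X
  let := restrictModule k A C
  have := restrictModule_isScalarTower k A C
  have : Module.Finite k C := Module.Finite.trans A C
  obtain ⟨m, f, hf⟩ := Module.Finite.exists_fin (R := k) (M := C →ₗ[A] X)
  have : Module.Projective A (Fin m → I) :=
    Module.Projective.of_equiv (DirectSum.linearEquivFunOnFintype A (Fin m) fun _ => I)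
  let φ : (Fin m → C) →ₗ[A] X := LinearMap.lsum A (fun _ => C) ℕ f
  let i' : (Fin m → C) →ₗ[A] (Fin m → I) := LinearMap.pi fun j => i ∘ₗ LinearMap.proj j
  have hi' : Function.Injective i' := fun c c' hc => funext fun j => h.injective (congrFun hc j)
  let p' : (Fin m → I) →ₗ[A] (Fin m → C') := LinearMap.pi fun j => p ∘ₗ LinearMap.proj j
  have hp' : Function.Surjective p' := fun c => by
    choose w hw using fun j => h.surjective (c j)
    exact ⟨w, funext hw⟩
  have hip' : Function.Exact i' p' := fun w => by
    constructor
    · intro hw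
      choose c hc using fun j => (h.exact (w j)).1 (congrFun hw j)
      exact ⟨c, funext hc⟩
    · rintro ⟨c, rfl⟩
      exact funext fun j => h.exact.apply_apply_eq_zero (c j)
  let R : Submodule A (X × (Fin m → I)) := (φ.prod (-i')).range
  have hR : ∀ c, R.mkQ (φ c, 0) = R.mkQ (0, i' c) := fun c =>
    (Submodule.Quotient.eq R).2 ⟨c, by simp⟩
  have hRq : R ≤ (p' ∘ₗ LinearMap.snd A X (Fin m → I)).ker := by
    rintro _ ⟨c, rfl⟩
    simp [hip'.apply_apply_eq_zero]
  let s : X →ₗ[A] (X × (Fin m → I)) ⧸ R := R.mkQ ∘ₗ LinearMap.inl A X (Fin m → I)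
  let q : ((X × (Fin m → I)) ⧸ R) →ₗ[A] (Fin m → C') :=
    R.liftQ (p' ∘ₗ LinearMap.snd A X (Fin m → I)) hRq
  refine ⟨ModuleCat.of A ((X × (Fin m → I)) ⧸ R),
    inferInstanceAs (Module.Finite A ((X × (Fin m → I)) ⧸ R)), s, m, q, ⟨?_, ?_, ?_⟩, ?_⟩
  · rw [injective_iff_map_eq_zero]
    intro x hx
    obtain ⟨c, hc⟩ := (Submodule.Quotient.mk_eq_zero R).1 hx
    have h1 : φ c = x := congrArg Prod.fst hc
    have h2 : -i' c = 0 := congrArg Prod.snd hc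
    rw [← h1, show c = 0 from hi' (by rw [map_zero, ← neg_eq_zero, h2]), map_zero]
  · intro y
    obtain ⟨⟨x, w⟩, rfl⟩ := R.mkQ_surjective y
    constructor
    · intro hw
      obtain ⟨c, rfl⟩ := (hip' w).1 hw
      refine ⟨x + φ c, ?_⟩
      change R.mkQ (x + φ c, 0) = R.mkQ (x, i' c)
      rw [show (x + φ c, (0 : Fin m → I)) = (x, 0) + (φ c, 0) by simp, map_add, hR, ← map_add]
      simp
    · rintro ⟨x', hx'⟩
      rw [← hx']
      exact map_zero p'
  · intro c
    obtain ⟨w, rfl⟩ := hp' c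
    exact ⟨R.mkQ (0, w), rfl⟩
  · intro g
    let := restrictModule k A ((X × (Fin m → I)) ⧸ R)
    have := restrictModule_isScalarTower k A ((X × (Fin m → I)) ⧸ R)
    have hg : g ∈ Submodule.span k (Set.range f) := hf ▸ Submodule.mem_top
    induction hg using Submodule.span_induction with
    | mem g hg =>
      obtain ⟨j, rfl⟩ := hg
      convert nullMap_comp (R.mkQ ∘ₗ LinearMap.inr A X (Fin m → I))
        (i' ∘ₗ LinearMap.single A (fun _ => C) j)
      ext c
      have := hR (Pi.single j c)
      simp only [φ, LinearMap.lsum_piSingle] at this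
      exact this
    | zero => simpa using nullMap_zero
    | add g g' _ _ hg hg' => simpa [LinearMap.comp_add] using hg.add hg'
    | smul c g _ hg =>
      have : s ∘ₗ (c • g) = c • (s ∘ₗ g) := by
        ext x
        simp only [LinearMap.comp_apply, LinearMap.smul_apply]
        rw [← algebraMap_smul A c, map_smul, algebraMap_smul]
      exact this ▸ hg.const_smul c

end UniversalExtension

/-! ## The filtered module killing all positive cosyzygies -/

section KillingFiltration

/-- A filtration with subquotients `C 0, (C 2)^m₁, (C 3)^m₂, …` such that all maps from `C (n+1)`
into the `(n+1)`-st piece become null in the next piece. -/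
structure KillingFiltration (A : Type) [Ring A] (C : ℕ → ModuleCat.{0} A) {X : Type}
    [AddCommGroup X] [Module A X] (F : ℕ → Submodule A X) : Prop where
  mono : Monotone F
  eq_bot : F 0 = ⊥
  iSup_eq_top : ⨆ n, F n = ⊤
  equiv_one : Nonempty (C 0 ≃ₗ[A] F 1)
  exists_quotient : ∀ n, ∃ (m : ℕ) (q : F (n + 2) →ₗ[A] (Fin m → C (n + 2))),
    Function.Surjective q ∧ q.ker = (F (n + 1)).comap (F (n + 2)).subtype
  null : ∀ (n : ℕ) (f : C (n + 1) →ₗ[A] F (n + 1)),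
    NullMap (Submodule.inclusion (mono (Nat.le_succ (n + 1))) ∘ₗ f)

theorem exists_killingFiltration (k : Type) {A : Type} [Field k] [Ring A] [Algebra k A]
    [FiniteDimensional k A] {C : ℕ → ModuleCat.{0} A} (hfin : ∀ n, Module.Finite A (C n))
    (hcos : ∀ n, HasFiniteCosyzygy A (C n) (C (n + 1))) :
    ∃ (X : ModuleCat.{0} A) (F : ℕ → Submodule A X), KillingFiltration A C F := by
  have step : ∀ (n : ℕ) (X : {X : ModuleCat.{0} A // Module.Finite A X}),
      ∃ (X' : {X : ModuleCat.{0} A // Module.Finite A X}) (s : X.1 →ₗ[A] X'.1) (m : ℕ)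
        (q : X'.1 →ₗ[A] (Fin m → C (n + 2))),
        IsShortExact s q ∧ ∀ f : C (n + 1) →ₗ[A] X.1, NullMap (s ∘ₗ f) := by
    rintro n ⟨X, hX⟩
    have := hfin (n + 1)
    obtain ⟨X', hX', s, m, q, h⟩ := exists_extension_killing k (hcos (n + 1)) X
    exact ⟨⟨X', hX'⟩, s, m, q, h⟩
  choose next s m q hsq hnull using step
  let X : ℕ → {X : ModuleCat.{0} A // Module.Finite A X} := fun n =>
    Nat.rec ⟨C 0, hfin 0⟩ next n
  obtain ⟨L, ι, hι, hιs, hL⟩ := exists_union_of_chain (fun n => (X n).1) (fun n => s n (X n))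
    (fun n => (hsq n (X n)).injective)
  let F : ℕ → Submodule A L := fun n => Nat.casesOn n ⊥ fun n => (ι n).range
  let ε : ∀ n, (X n).1 ≃ₗ[A] F (n + 1) := fun n => LinearEquiv.ofInjective (ι n) (hι n)
  have hε : ∀ n x, (ε (n + 1) (s n (X n) x) : L) = ε n x := fun n x =>
    LinearMap.congr_fun (hιs n) x
  have hF : Monotone F := monotone_nat_of_le_succ fun n => by
    cases n with
    | zero => exact bot_le
    | succ n =>
      rintro _ ⟨x, rfl⟩
      exact ⟨s n (X n) x, LinearMap.congr_fun (hιs n) x⟩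
  refine ⟨L, F, hF, rfl, ?_, ⟨ε 0⟩, fun n => ⟨m n (X n), q n (X n) ∘ₗ (ε (n + 1)).symm.toLinearMap,
    (hsq n (X n)).surjective.comp (ε (n + 1)).symm.surjective, ?_⟩, fun n f => ?_⟩
  · rw [eq_top_iff]
    rintro x -
    obtain ⟨n, y, rfl⟩ := hL x
    exact Submodule.mem_iSup_of_mem (n + 1) ⟨y, rfl⟩
  · ext y
    obtain ⟨x, rfl⟩ := (ε (n + 1)).surjective y
    rw [LinearMap.mem_ker, LinearMap.comp_apply, LinearEquiv.coe_coe,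
      LinearEquiv.symm_apply_apply, (hsq n (X n)).exact x, Submodule.mem_comap,
      Submodule.subtype_apply]
    constructor
    · rintro ⟨z, rfl⟩
      rw [hε]
      exact (ε n z).2
    · rintro ⟨z, hz⟩
      exact ⟨z, (ε (n + 1)).injective (Subtype.ext ((hε n z).trans hz))⟩
  · convert (hnull n (X n) ((ε n).symm.toLinearMap ∘ₗ f)).comp_left (ε (n + 1)).toLinearMap
    refine LinearMap.ext fun x => Subtype.ext ?_
    refine Eq.trans ?_ (hε n _).symm
    simp

variable {A : Type} [Ring A] {M : ModuleCat.{0} A} {C : ℕ → ModuleCat.{0} A} {X : Type}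
  [AddCommGroup X] [Module A X] {F : ℕ → Submodule A X}

theorem stZero_of_filtration {Z : Type} [AddCommGroup Z] [Module A Z] [Module.Finite A Z]
    (hF : Monotone F) (htop : ⨆ n, F n = ⊤) (h : ∀ n, ∃ N, n ≤ N ∧ StZero A Z (F N)) :
    StZero A Z X := fun f => by
  obtain ⟨n, hn⟩ := exists_forall_mem_of_finite hF htop f
  obtain ⟨N, hN, hZ⟩ := h n
  exact (hZ (f.codRestrict (F N) fun z => hF hN (hn z))).comp_left (F N).subtype

namespace KillingFiltration

theorem stZero_of_forall (hF : KillingFiltration A C F) {Z : Type} [AddCommGroup Z] [Module A Z]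
    [Module.Finite A Z] (hZ : ∀ n, StZero A Z (C n)) : StZero A Z X := by
  have key : ∀ n, StZero A Z (F (n + 1)) := by
    intro n
    induction n with
    | zero => exact (hZ 0).congr_right hF.equiv_one.some
    | succ n ih =>
      obtain ⟨m, q, hq, hker⟩ := hF.exists_quotient n
      exact (isShortExact_inclusion (hF.mono (Nat.le_succ (n + 1))) hq hker).stZero ih
        (StZero.pi fun _ => hZ _)
  exact stZero_of_filtration hF.mono hF.iSup_eq_top fun n => ⟨n + 1, n.le_succ, key n⟩

theorem stZero (hC : OrthogonalCosyzygies A M C) (hF : KillingFiltration A C F) (j : ℕ) :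
    StZero A (C (j + 1)) X := by
  have := hC.finite (j + 1)
  have key : ∀ n, j + 1 ≤ n → StZero A (C (j + 1)) (F (n + 1)) := by
    intro n hn
    induction n, hn using Nat.le_induction with
    | base =>
      intro f
      obtain ⟨m, q, hq, hker⟩ := hF.exists_quotient j
      have hex := isShortExact_inclusion (hF.mono (Nat.le_succ (j + 1))) hq hker
      have hm : StZero A (C (j + 1)) (Fin m → C (j + 2)) :=
        StZero.pi fun _ => hC.stZero_of_lt _ _ (Nat.lt_succ_self _)
      obtain ⟨g, hg, hgf⟩ := (hm (q ∘ₗ f)).exists_lift q hq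
      obtain ⟨d, hd⟩ := LinearMap.exists_comp_eq_of_injective _ hex.injective (f - g) fun w =>
        (hex.exact _).1 (by
          have := LinearMap.congr_fun hgf w
          simp only [LinearMap.comp_apply] at this
          simp [this])
      have := (hF.null j d).add hg
      rwa [hd, sub_add_cancel] at this
    | succ n hn ih =>
      obtain ⟨m, q, hq, hker⟩ := hF.exists_quotient n
      exact (isShortExact_inclusion (hF.mono (Nat.le_succ (n + 1))) hq hker).stZero ih
        (StZero.pi fun _ => hC.stZero_of_lt _ _ (by lia))
  exact stZero_of_filtration hF.mono hF.iSup_eq_top fun n =>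
    ⟨n + (j + 1) + 1, by lia, key _ (by lia)⟩

theorem memG {X : ModuleCat.{0} A} {F : ℕ → Submodule A X} (hC : OrthogonalCosyzygies A M C)
    (hF : KillingFiltration A C F) : MemG A M X := by
  intro n hn
  obtain ⟨n, rfl⟩ : ∃ n', n = n' + 1 := ⟨n - 1, by lia⟩
  obtain ⟨K, hK, hKC, hKext⟩ := hC.extZero_right_iff
  have := hK n
  exact ⟨(hKext n X).2 (hF.stZero_of_forall (hKC n)),
    (hC.extZero_left_iff n X).2 (hF.stZero hC (n + 1))⟩

theorem exists_quotient_equiv (hF : KillingFiltration A C F) (n : ℕ) :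
    ∃ m : ℕ, Nonempty ((↥(F (n + 2)) ⧸ (Submodule.comap (F (n + 2)).subtype (F (n + 1)))) ≃ₗ[A]
      (Fin m → C (n + 2))) := by
  obtain ⟨m, q, hq, hker⟩ := hF.exists_quotient n
  exact ⟨m, ⟨(Submodule.quotEquivOfEq _ _ hker.symm).trans (q.quotKerEquivOfSurjective hq)⟩⟩

theorem mFiltered {X : ModuleCat.{0} A} {F : ℕ → Submodule A X} (hF : KillingFiltration A C F) :
    MFiltered A C X := by
  refine ⟨F, hF.mono, hF.eq_bot, hF.iSup_eq_top, fun n => ?_⟩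
  cases n with
  | zero =>
    refine ⟨1, fun _ => some 0, ⟨?_⟩⟩
    have h : Submodule.comap (F 1).subtype (F 0) = ⊥ := by
      rw [hF.eq_bot, Submodule.comap_bot, Submodule.ker_subtype]
    exact ((Submodule.quotEquivOfEqBot _ h).trans hF.equiv_one.some.symm).trans
      (LinearEquiv.funUnique (Fin 1) A (C 0)).symm
  | succ n =>
    obtain ⟨m, ⟨e⟩⟩ := hF.exists_quotient_equiv n
    exact ⟨m, fun _ => some (n + 2), ⟨e⟩⟩

/-- A map that vanishes on the first piece is null if all maps from `C (n+2)` are null. -/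
theorem nullMap [ProjectivesInjective A] (hF : KillingFiltration A C F) {Y : Type}
    [AddCommGroup Y] [Module A Y] (hY : ∀ n, StZero A (C (n + 2)) Y) (f : X →ₗ[A] Y)
    (hf : ∀ x ∈ F 1, f x = 0) : NullMap f := by
  refine nullMap_of_filtration (F := fun n => F (n + 1)) (fun a b h => hF.mono (by lia)) ?_
    (fun n => ?_) f hf
  · rw [eq_top_iff, ← hF.iSup_eq_top]
    exact iSup_le fun n => (hF.mono n.le_succ).trans (le_iSup (fun n => F (n + 1)) n)
  · obtain ⟨m, ⟨e⟩⟩ := hF.exists_quotient_equiv n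
    exact (StZero.of_pi fun _ : Fin m => hY n).congr_left e.symm

end KillingFiltration

end KillingFiltration

/-! ## Coproducts and maps out of finitely generated modules -/

section FiniteSupport

variable {A : Type} [Ring A]

theorem exists_eq_sum_of_finite {ι Y Z : Type} [AddCommGroup Y] [Module A Y] [AddCommGroup Z]
    [Module A Z] [Module.Finite A Z] {Y' : ι → Type} [∀ i, AddCommGroup (Y' i)]
    [∀ i, Module A (Y' i)] (a : ∀ i, Y' i →ₗ[A] Y) (b : ∀ i, Y →ₗ[A] Y' i)
    (h : ∀ y, ∃ S : Finset ι, ∀ T, S ⊆ T → ∑ i ∈ T, a i (b i y) = y) (f : Z →ₗ[A] Y) :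
    ∃ S : Finset ι, f = ∑ i ∈ S, a i ∘ₗ b i ∘ₗ f := by
  classical
  obtain ⟨r, x, hx⟩ := Module.Finite.exists_fin (R := A) (M := Z)
  choose S hS using h
  refine ⟨Finset.univ.biUnion fun j => S (f (x j)), LinearMap.ext_on_range hx fun j => ?_⟩
  rw [LinearMap.sum_apply]
  exact (hS (f (x j)) _ fun i hi => Finset.mem_biUnion.2 ⟨j, Finset.mem_univ j, hi⟩).symm

theorem Finsupp.exists_sum_lsingle_lapply {I M : Type} [AddCommGroup M] [Module A M]
    (y : I →₀ M) : ∃ S : Finset I, ∀ T, S ⊆ T →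
      ∑ i ∈ T, Finsupp.lsingle (R := A) i (Finsupp.lapply (R := A) i y) = y :=
  ⟨y.support, fun T hT => by
    conv_rhs => rw [← Finsupp.sum_single y]
    exact (Finsupp.sum_of_support_subset y hT _ fun i _ => Finsupp.single_zero i).symm⟩

theorem ModuleCat.exists_sum_sigmaι_sigmaπ {I : Type} [DecidableEq I] (Y : I → ModuleCat.{0} A)
    (y : (∐ Y : ModuleCat.{0} A)) : ∃ S : Finset I, ∀ T, S ⊆ T →
      ∑ i ∈ T, (Limits.Sigma.ι Y i).hom ((Limits.Sigma.π Y i).hom y) = y := by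
  obtain ⟨z, rfl⟩ : ∃ z, (ModuleCat.coprodIsoDirectSum Y).inv.hom z = y :=
    ⟨(ModuleCat.coprodIsoDirectSum Y).hom.hom y, by
      rw [← LinearMap.comp_apply, ← ModuleCat.hom_comp, Iso.hom_inv_id]
      rfl⟩
  induction z using DirectSum.induction_on with
  | zero => exact ⟨∅, fun T _ => by simp⟩
  | of i z =>
    refine ⟨{i}, fun T hT => ?_⟩
    have hz : (ModuleCat.coprodIsoDirectSum Y).inv.hom (DirectSum.of (fun i => Y i) i z) =
        (Limits.Sigma.ι Y i).hom z :=
      LinearMap.congr_fun (congrArg ModuleCat.Hom.hom (ModuleCat.lof_coprodIsoDirectSum_inv Y i)) z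
    rw [hz, Finset.sum_eq_single_of_mem i (hT (Finset.mem_singleton_self i))]
    · rw [← LinearMap.comp_apply (Limits.Sigma.π Y i).hom, ← ModuleCat.hom_comp,
        Limits.Sigma.ι_π_eq_id]
      rfl
    · intro j _ hj
      rw [← LinearMap.comp_apply (Limits.Sigma.π Y j).hom, ← ModuleCat.hom_comp,
        Limits.Sigma.ι_π_of_ne Y hj.symm]
      exact map_zero _
  | add z w hz hw =>
    obtain ⟨S, hS⟩ := hz
    obtain ⟨S', hS'⟩ := hw
    refine ⟨S ∪ S', fun T hT => ?_⟩
    simp only [map_add, Finset.sum_add_distrib]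
    rw [hS T (Finset.union_subset_left hT), hS' T (Finset.union_subset_right hT)]

end FiniteSupport

/-! ## Projective modules lie in `Add M` -/

section AddM

variable {A : Type} [Ring A] {M : ModuleCat.{0} A}

theorem memAddBig_of_retract {X : ModuleCat.{0} A} {I : Type} (i : X →ₗ[A] (I →₀ M))
    (r : (I →₀ M) →ₗ[A] X) (hri : r ∘ₗ i = LinearMap.id) : MemAddBig A M X := by
  have hri' : ∀ x, r (i x) = x := LinearMap.congr_fun hri
  refine ⟨I, ModuleCat.of A r.ker,
    ⟨LinearEquiv.ofBijective (i.coprod r.ker.subtype) ⟨?_, fun y => ?_⟩⟩⟩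
  · rw [injective_iff_map_eq_zero]
    rintro ⟨x, y⟩ h
    simp only [LinearMap.coprod_apply, Submodule.subtype_apply] at h
    have hx : x = 0 := by
      have := congrArg r h
      rwa [map_add, hri', LinearMap.mem_ker.1 y.2, add_zero, map_zero] at this
    subst hx
    rw [map_zero, zero_add] at h
    exact Prod.ext rfl (Subtype.ext h)
  · exact ⟨(r y, ⟨y - i (r y), by simp [hri']⟩), by simp⟩

theorem IsGen.memAddBig (hgen : IsGen A M) (P : ModuleCat.{0} A) [Module.Projective A P] :
    MemAddBig A M P := by
  obtain ⟨n, N, ⟨e⟩⟩ := hgen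
  obtain ⟨s, hs⟩ := (Finsupp.linearCombination A (id : P → P)).exists_rightInverse_of_surjective
    (LinearMap.range_eq_top.2 (Finsupp.linearCombination_id_surjective A P))
  let i : A →ₗ[A] (Fin n →₀ M) :=
    (Finsupp.linearEquivFunOnFinite A M (Fin n)).symm.toLinearMap ∘ₗ e.toLinearMap ∘ₗ
      LinearMap.inl A A N
  let r : (Fin n →₀ M) →ₗ[A] A :=
    LinearMap.fst A A N ∘ₗ e.symm.toLinearMap ∘ₗ
      (Finsupp.linearEquivFunOnFinite A M (Fin n)).toLinearMap
  have hri : ∀ a, r (i a) = a := fun a => by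
    simp only [r, i, LinearMap.comp_apply, LinearEquiv.coe_coe, LinearEquiv.apply_symm_apply,
      LinearEquiv.symm_apply_apply]
    rfl
  let c : ((P × Fin n) →₀ M) ≃ₗ[A] (P →₀ Fin n →₀ M) := Finsupp.curryLinearEquiv A
  refine memAddBig_of_retract (c.symm.toLinearMap ∘ₗ Finsupp.mapRange.linearMap i ∘ₗ s)
    (Finsupp.linearCombination A id ∘ₗ Finsupp.mapRange.linearMap r ∘ₗ c.toLinearMap) ?_
  ext x
  have h : ∀ w : P →₀ A, Finsupp.mapRange.linearMap r (Finsupp.mapRange.linearMap i w) = w :=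
    fun w => Finsupp.ext fun p => hri (w p)
  simp only [LinearMap.comp_apply, LinearEquiv.coe_coe, LinearEquiv.apply_symm_apply, h]
  exact LinearMap.congr_fun hs x

theorem IsGen.mem_addMSub (hgen : IsGen A M) {X Y : ModuleCat.{0} A} {f : X ⟶ Y}
    (hf : NullMap f.hom) : f ∈ addMSub A M X Y := by
  obtain ⟨P, _, g, h, hgh⟩ := hf
  refine AddSubgroup.subset_closure ⟨P, hgen.memAddBig P, ModuleCat.ofHom g, ModuleCat.ofHom h, ?_⟩
  ext1
  exact hgh.symm

end AddM

/-! ## The killing module is `M`-compact -/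

section Compact

variable {A : Type} [Ring A] {M : ModuleCat.{0} A}

theorem stPostComp_stPostComp {X Y Z W : ModuleCat.{0} A} (g : Y ⟶ Z) (h : Z ⟶ W)
    (x : StHomM A M X Y) :
    stPostComp A M X h (stPostComp A M X g x) = stPostComp A M X (g ≫ h) x := by
  obtain ⟨f, rfl⟩ := QuotientAddGroup.mk_surjective x
  exact congrArg (QuotientAddGroup.mk (s := addMSub A M X W)) (Category.assoc f g h)

theorem stPostComp_id {X Y : ModuleCat.{0} A} (x : StHomM A M X Y) :
    stPostComp A M X (𝟙 Y) x = x := by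
  obtain ⟨f, rfl⟩ := QuotientAddGroup.mk_surjective x
  exact congrArg (QuotientAddGroup.mk (s := addMSub A M X Y)) (Category.comp_id f)

theorem stPostComp_zero {X Y Z : ModuleCat.{0} A} (x : StHomM A M X Y) :
    stPostComp A M X (0 : Y ⟶ Z) x = 0 := by
  obtain ⟨f, rfl⟩ := QuotientAddGroup.mk_surjective x
  exact congrArg (QuotientAddGroup.mk (s := addMSub A M X Z)) (Limits.comp_zero (f := f))

theorem stCanonMap_of {X : ModuleCat.{0} A} {I : Type} [DecidableEq I] (Y : I → ModuleCat.{0} A)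
    (i : I) (x : StHomM A M X (Y i)) :
    stCanonMap A M X I Y (DirectSum.of (fun i => StHomM A M X (Y i)) i x) =
      stPostComp A M X (Limits.Sigma.ι Y i) x := by
  unfold stCanonMap
  convert DirectSum.toAddMonoid_of (fun i => stPostComp A M X (Limits.Sigma.ι Y i)) i x

theorem stPostComp_stCanonMap {X : ModuleCat.{0} A} {I : Type} [DecidableEq I]
    (Y : I → ModuleCat.{0} A) (i : I) (x : DirectSum I fun i => StHomM A M X (Y i)) :
    stPostComp A M X (Limits.Sigma.π Y i) (stCanonMap A M X I Y x) = x i := by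
  induction x using DirectSum.induction_on with
  | zero => simp
  | of j x =>
    rw [stCanonMap_of, stPostComp_stPostComp]
    rcases eq_or_ne j i with rfl | hj
    · rw [Limits.Sigma.ι_π_eq_id, stPostComp_id, DirectSum.of_eq_same]
    · rw [Limits.Sigma.ι_π_of_ne Y hj, stPostComp_zero, DirectSum.of_eq_of_ne _ _ _ hj.symm]
  | add x y hx hy => rw [map_add, map_add, hx, hy, DirectSum.add_apply]

theorem stCanonMap_injective (X : ModuleCat.{0} A) {I : Type} (Y : I → ModuleCat.{0} A) :
    Function.Injective (stCanonMap A M X I Y) := fun x y h => DFinsupp.ext fun i => by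
  classical
  have := congrArg (stPostComp A M X (Limits.Sigma.π Y i)) h
  rwa [stPostComp_stCanonMap, stPostComp_stCanonMap] at this

theorem StZero.sigma {Z : Type} [AddCommGroup Z] [Module A Z] [Module.Finite A Z] {I : Type}
    {Y : I → ModuleCat.{0} A} (h : ∀ i, StZero A Z (Y i)) :
    StZero A Z (∐ Y : ModuleCat.{0} A) := fun f => by
  classical
  obtain ⟨S, hS⟩ := exists_eq_sum_of_finite _ _ (ModuleCat.exists_sum_sigmaι_sigmaπ Y) f
  rw [hS]
  exact NullMap.sum S fun i _ => (h i _).comp_left _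

theorem KillingFiltration.mCompact [ProjectivesInjective A] {C : ℕ → ModuleCat.{0} A}
    {X : ModuleCat.{0} A} {F : ℕ → Submodule A X} (hgen : IsGen A M)
    (hC : OrthogonalCosyzygies A M C) (hF : KillingFiltration A C F) : MCompact A M X := by
  classical
  refine ⟨hF.memG hC, fun I Y hY => ⟨stCanonMap_injective X Y, fun x => ?_⟩⟩
  obtain ⟨f, rfl⟩ := QuotientAddGroup.mk_surjective x
  have := hC.finite 0
  have : Module.Finite A (F 1) := Module.Finite.equiv hF.equiv_one.some
  obtain ⟨S, hS⟩ := exists_eq_sum_of_finite _ _ (ModuleCat.exists_sum_sigmaι_sigmaπ Y)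
    (f.hom ∘ₗ (F 1).subtype)
  let g : X ⟶ ∐ Y := ∑ i ∈ S, (f ≫ Limits.Sigma.π Y i) ≫ Limits.Sigma.ι Y i
  have hnull : NullMap (f - g).hom := by
    refine hF.nullMap (fun n => ?_) _ fun x hx => ?_
    · have := hC.finite (n + 2)
      exact StZero.sigma fun i => (hC.extZero_left_iff n (Y i)).1 (hY i (n + 1) (by lia)).2
    · have := LinearMap.congr_fun hS ⟨x, hx⟩
      simp only [LinearMap.sum_apply, LinearMap.comp_apply, Submodule.subtype_apply] at this
      rw [ModuleCat.hom_sub, LinearMap.sub_apply, this, sub_eq_zero]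
      simp [g, ModuleCat.hom_sum]
  refine ⟨∑ i ∈ S, DirectSum.of (fun i => StHomM A M X (Y i)) i
    (QuotientAddGroup.mk (f ≫ Limits.Sigma.π Y i)), ?_⟩
  have hg : stCanonMap A M X I Y (∑ i ∈ S, DirectSum.of (fun i => StHomM A M X (Y i)) i
      (QuotientAddGroup.mk (f ≫ Limits.Sigma.π Y i))) =
      QuotientAddGroup.mk' (addMSub A M X (∐ Y)) g := by
    rw [map_sum, map_sum]
    exact Finset.sum_congr rfl fun i _ => stCanonMap_of Y i _
  rw [hg]
  refine (QuotientAddGroup.eq (s := addMSub A M X (∐ Y))).2 ?_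
  rw [neg_add_eq_sub]
  exact hgen.mem_addMSub hnull

end Compact

/-! ## Projectivity of `M` -/

section Conclusion

variable {A : Type} [Ring A] {M : ModuleCat.{0} A} {C : ℕ → ModuleCat.{0} A}

theorem projective_of_nullMap_id {X : Type} [AddCommGroup X] [Module A X]
    (h : NullMap (LinearMap.id : X →ₗ[A] X)) : Module.Projective A X := by
  obtain ⟨P, _, g, h, hgh⟩ := h
  exact Module.Projective.of_split g h hgh

/-- Null maps can be detected after an extension whose cokernel receives only null maps from the
cosyzygy of the source. -/
theorem IsShortExact.nullMap_of_comp [ProjectivesInjective A] {X Y Q Z Z' : Type}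
    [AddCommGroup X] [Module A X] [AddCommGroup Y] [Module A Y] [AddCommGroup Q] [Module A Q]
    [AddCommGroup Z] [Module A Z] [AddCommGroup Z'] [Module A Z'] {s : X →ₗ[A] Y} {q : Y →ₗ[A] Q}
    (hsq : IsShortExact s q) (hZ : IsSyzygy A Z Z') (hQ : StZero A Z' Q) {u : Z →ₗ[A] X}
    (hu : NullMap (s ∘ₗ u)) : NullMap u := by
  obtain ⟨P, _, j, p, h⟩ := hZ
  obtain ⟨v, hv⟩ := hu.exists_extension j h.injective
  have hv' : ∀ z, v (j z) = s (u z) := LinearMap.congr_fun hv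
  obtain ⟨d, hd⟩ := p.exists_comp_eq_of_surjective h.surjective (q ∘ₗ v) fun w hw => by
    obtain ⟨z, rfl⟩ := (h.exact w).1 hw
    rw [LinearMap.comp_apply, hv', hsq.exact.apply_apply_eq_zero]
  obtain ⟨d', -, hd'⟩ := (hQ d).exists_lift q hsq.surjective
  obtain ⟨t, ht⟩ := s.exists_comp_eq_of_injective hsq.injective (v - d' ∘ₗ p) fun w =>
    (hsq.exact _).1 (by
      have h1 := LinearMap.congr_fun hd w
      rw [← hd'] at h1
      simp only [LinearMap.comp_apply] at h1
      simp [h1])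
  convert nullMap_comp t j
  ext z
  apply hsq.injective
  have h1 := LinearMap.congr_fun ht (j z)
  simp only [LinearMap.comp_apply, LinearMap.sub_apply, h.exact.apply_apply_eq_zero, map_zero,
    sub_zero, hv'] at h1
  rw [LinearMap.comp_apply, h1]

theorem MemAddBig.nullMap_of_finite {X : ModuleCat.{0} A} (hX : MemAddBig A M X)
    (hXM : StZero A X M) {Z : Type} [AddCommGroup Z] [Module A Z] [Module.Finite A Z]
    (u : Z →ₗ[A] X) : NullMap u := by
  obtain ⟨I, Y, ⟨e⟩⟩ := hX
  let j : X →ₗ[A] (I →₀ M) := e.toLinearMap ∘ₗ LinearMap.inl A X Y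
  obtain ⟨S, hS⟩ := exists_eq_sum_of_finite _ _ Finsupp.exists_sum_lsingle_lapply (j ∘ₗ u)
  have hju : NullMap (j ∘ₗ u) := by
    rw [hS]
    exact NullMap.sum S fun i _ => ((hXM (Finsupp.lapply i ∘ₗ j)).comp_right u).comp_left _
  convert hju.comp_left (LinearMap.fst A X Y ∘ₗ e.symm.toLinearMap)
  ext z
  simp [j]

theorem KillingFiltration.projective [ProjectivesInjective A] {X : ModuleCat.{0} A}
    {F : ℕ → Submodule A X} (hC : OrthogonalCosyzygies A M C) (hF : KillingFiltration A C F)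
    (hX : MemAddBig A M X) : Module.Projective A M := by
  obtain ⟨ε⟩ := hF.equiv_one
  have := hC.finite 0
  obtain ⟨I, _, _, i, p, h⟩ := hC.hasFiniteCosyzygy 0
  have hXM : StZero A X M := (hC.stZero_one_iff X).1 (hF.stZero hC 0)
  obtain ⟨v, hv⟩ := (hX.nullMap_of_finite hXM ((F 1).subtype ∘ₗ ε.toLinearMap)).exists_extension
    i h.injective
  obtain ⟨N, hN⟩ := exists_forall_mem_of_finite hF.mono hF.iSup_eq_top v
  have hnull : NullMap (Submodule.inclusion (hF.mono (Nat.le_add_left 1 N)) ∘ₗ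
      ε.toLinearMap) := by
    convert nullMap_comp (v.codRestrict (F (N + 1)) fun w => hF.mono N.le_succ (hN w)) i
    refine LinearMap.ext fun z => Subtype.ext ?_
    exact (LinearMap.congr_fun hv z).symm
  have descend : ∀ n, NullMap (Submodule.inclusion (hF.mono (Nat.le_add_left 1 n)) ∘ₗ
      ε.toLinearMap) → NullMap ε.toLinearMap := by
    intro n
    induction n with
    | zero => exact id
    | succ n ih =>
      intro hn
      obtain ⟨m, q, hq, hker⟩ := hF.exists_quotient n
      exact ih ((isShortExact_inclusion (hF.mono (Nat.le_succ (n + 1))) hq hker).nullMap_of_comp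
        (hC.hasFiniteCosyzygy 0).isSyzygy (StZero.pi fun _ => hC.stZero_of_lt _ _ (by lia)) hn)
  have hid := (descend N hnull).comp_left ε.symm.toLinearMap
  rw [LinearEquiv.comp_coe, LinearEquiv.self_trans_symm] at hid
  have := projective_of_nullMap_id hid
  exact Module.Projective.of_equiv hC.equiv.some

theorem IsSyzygy.projective [ProjectivesInjective A] {Z Z' : Type} [AddCommGroup Z] [Module A Z]
    [AddCommGroup Z'] [Module A Z'] (h : IsSyzygy A Z Z') [Module.Projective A Z] :
    Module.Projective A Z' := by
  obtain ⟨P, _, i, p, h⟩ := h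
  obtain ⟨r, hr⟩ := exists_extension i h.injective LinearMap.id
  have hr' : ∀ z, r (i z) = z := LinearMap.congr_fun hr
  obtain ⟨t, ht⟩ := p.exists_comp_eq_of_surjective h.surjective (LinearMap.id - i ∘ₗ r)
    fun w hw => by
      obtain ⟨z, rfl⟩ := (h.exact w).1 hw
      simp [hr']
  refine Module.Projective.of_split t p (LinearMap.ext fun z => ?_)
  obtain ⟨w, rfl⟩ := h.surjective z
  have := LinearMap.congr_fun ht w
  simp only [LinearMap.comp_apply, LinearMap.sub_apply, LinearMap.id_apply] at this
  simp [this, h.exact.apply_apply_eq_zero]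

theorem MFiltered.projective [ProjectivesInjective A] {X : ModuleCat.{0} A}
    (hC : ∀ n, Module.Projective A (C n)) (hX : MFiltered A C X) : Module.Projective A X := by
  obtain ⟨F, hF, hbot, htop, hgr⟩ := hX
  refine projective_of_nullMap_id (nullMap_of_filtration hF htop (fun n => ?_) _ fun x hx => ?_)
  · obtain ⟨m, T, ⟨e⟩⟩ := hgr n
    refine StZero.congr_left (StZero.of_pi fun j => ?_) e.symm
    have : Module.Projective A (optPick A C (T j)) := by
      cases T j with
      | none => exact inferInstanceAs (Module.Projective A A)
      | some n => exact hC n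
    exact StZero.of_projective_left
  · rw [hbot] at hx
    exact (Submodule.mem_bot A).1 hx

end Conclusion

/-- **Theorem 1.2, (1) ⇔ (3)**. `M` is projective iff every `A`-module that is both
`M`-compact and `M`-filtered lies in `Add M`. Here `C` is the sequence of cosyzygies
`Ω_A^{-i}(M)` of `M` along a minimal injective coresolution. -/
theorem tachikawa_second_conjecture_iff_M_compact_filtered
    (k A : Type) [Field k] [Ring A] [Algebra k A] [FiniteDimensional k A]
    [Module.Injective A A]
    (M : ModuleCat.{0} A) [Module.Finite A ↥M]
    (hgen : IsGen A M) (hso : SelfOrthogonal A M) (hns : NakayamaStable k A M)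
    (C : ℕ → ModuleCat.{0} A) (hC : IsMinInjCoresolution A M C) :
    Module.Projective A ↥M ↔
      ∀ X : ModuleCat.{0} A, MCompact A M X → MFiltered A C X → MemAddBig A M X := by
  have : ProjectivesInjective A := ⟨fun N _ _ _ => injective_of_projective k A N⟩
  have hO := hC.orthogonalCosyzygies k hso hns
  constructor
  · intro hM X _ hX
    have hproj : ∀ n, Module.Projective A (C n) := by
      intro n
      induction n with
      | zero => exact Module.Projective.of_equiv hO.equiv.some.symm
      | succ n ih => exact (hO.hasFiniteCosyzygy n).isSyzygy.projective
    have := hX.projective hproj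
    exact hgen.memAddBig X
  · intro h
    obtain ⟨X, F, hF⟩ := exists_killingFiltration k hO.finite hO.hasFiniteCosyzygy
    exact hF.projective hO (h X (hF.mCompact hgen hO) hF.mFiltered)
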